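/- arXiv:2111.10122 — 4 statements merged into one kernel-verified Lean document; each statement's English description precedes it below -/
import Mathlib

section
/- Let Z = ℓ₁ ⊕₂ ℝ and let F : B_Z → B_Z be a non-expansive bijection of the closed unit ball onto itself. Then either F(0, 1) = (0, 1) or F(0, 1) = (0, −1), where (0, ±1) denotes the element of Z with zero ℓ₁-component and real component ±1. -/
/-- The real sequence space ℓ₁. -/
noncomputable abbrev Ell1 : Type := lp (fun _ : ℕ => ℝ) 1

/-- The space Z = ℓ₁ ⊕₂ ℝ, with norm ‖(x,t)‖ = √(‖x‖₁² + t²). -/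
noncomputable abbrev Z : Type := WithLp 2 (Ell1 × ℝ)

/-- The element (x, t) of Z = ℓ₁ ⊕₂ ℝ. -/
noncomputable def zmk (x : Ell1) (t : ℝ) : Z := (WithLp.equiv 2 (Ell1 × ℝ)).symm (x, t)


open Set
lemma sierp_step {ι : Type*} (f : ℝ → ι) (c d : ℝ) (hcd : c ≤ d)
    (hcl : ∀ i, IsClosed {x | x ∈ Icc c d ∧ f x = i}) (hne : f c ≠ f d) (σ : ι) :
    ∃ c' d', c ≤ c' ∧ c' ≤ d' ∧ d' ≤ d ∧ f c' ≠ f d' ∧ ∀ x ∈ Icc c' d', f x ≠ σ := by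
  by_cases hT : {x | x ∈ Icc c d ∧ f x = σ} = ∅
  · refine ⟨c, d, le_rfl, hcd, le_rfl, hne, fun x hx h => ?_⟩
    have : x ∈ {x | x ∈ Icc c d ∧ f x = σ} := ⟨hx, h⟩
    rw [hT] at this; exact this
  have hT := nonempty_iff_ne_empty.2 hT
  by_cases hc : f c = σ
  · have hb : BddAbove {x | x ∈ Icc c d ∧ f x = σ} := ⟨d, fun x hx => hx.1.2⟩
    have hm := (hcl σ).csSup_mem hT hb
    set m := sSup {x | x ∈ Icc c d ∧ f x = σ} with hmdef
    have hmd : m < d := lt_of_le_of_ne hm.1.2 (fun h => hne (by rw [hc, ← h, hm.2]))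
    obtain ⟨x, hx, hfx⟩ : ∃ x ∈ Ioc m d, f x ≠ f d := by
      by_contra! H
      have h1 : Ioc m d ⊆ {x | x ∈ Icc c d ∧ f x = f d} :=
        fun x hx => ⟨⟨hm.1.1.trans hx.1.le, hx.2⟩, H x hx⟩
      have h2 := (hcl (f d)).closure_subset_iff.2 h1
      rw [closure_Ioc hmd.ne] at h2
      have h3 := (h2 ⟨le_rfl, hmd.le⟩).2
      exact hne (by rw [hc, ← h3, hm.2])
    refine ⟨x, d, hm.1.1.trans hx.1.le, hx.2, le_rfl, hfx, fun y hy h => ?_⟩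
    have : y ≤ m := le_csSup hb ⟨⟨hm.1.1.trans (hx.1.le.trans hy.1), hy.2⟩, h⟩
    linarith [hx.1, hy.1]
  · have hb : BddBelow {x | x ∈ Icc c d ∧ f x = σ} := ⟨c, fun x hx => hx.1.1⟩
    have hm := (hcl σ).csInf_mem hT hb
    set m := sInf {x | x ∈ Icc c d ∧ f x = σ} with hmdef
    have hmd : c < m := lt_of_le_of_ne hm.1.1 (fun h => hc (by rw [h, hm.2]))
    obtain ⟨x, hx, hfx⟩ : ∃ x ∈ Ico c m, f x ≠ f c := by
      by_contra! H
      have h1 : Ico c m ⊆ {x | x ∈ Icc c d ∧ f x = f c} :=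
        fun x hx => ⟨⟨hx.1, hx.2.le.trans hm.1.2⟩, H x hx⟩
      have h2 := (hcl (f c)).closure_subset_iff.2 h1
      rw [closure_Ico hmd.ne] at h2
      have h3 := (h2 ⟨hmd.le, le_rfl⟩).2
      exact hc (by rw [← h3, hm.2])
    refine ⟨c, x, le_rfl, hx.1, hx.2.le.trans hm.1.2, hfx.symm, fun y hy h => ?_⟩
    have : m ≤ y := csInf_le hb ⟨⟨hy.1, hy.2.trans (hx.2.le.trans hm.1.2)⟩, h⟩
    linarith [hx.2, hy.2]

lemma sierp {ι : Type*} [Countable ι] (f : ℝ → ι) (a b : ℝ) (hab : a ≤ b)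
    (hcl : ∀ i, IsClosed {x | x ∈ Icc a b ∧ f x = i}) : f a = f b := by
  by_contra hne
  have : Nonempty ι := ⟨f a⟩
  obtain ⟨u, hu⟩ := exists_surjective_nat ι
  let P := {q : ℝ × ℝ // a ≤ q.1 ∧ q.1 ≤ q.2 ∧ q.2 ≤ b ∧ f q.1 ≠ f q.2}
  have step : ∀ (σ : ι) (q : P), ∃ q' : P, q.1.1 ≤ q'.1.1 ∧ q'.1.2 ≤ q.1.2 ∧
      ∀ x ∈ Icc q'.1.1 q'.1.2, f x ≠ σ := by
    rintro σ ⟨⟨c, d⟩, h1, h2, h3, h4⟩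
    have hcl' : ∀ i, IsClosed {x | x ∈ Icc c d ∧ f x = i} := by
      intro i
      convert (hcl i).inter (isClosed_Icc (a := c) (b := d)) using 1
      ext x
      simp only [mem_ofPred_eq, mem_inter_iff, mem_Icc] at *
      constructor
      · rintro ⟨⟨h, h'⟩, h''⟩; exact ⟨⟨⟨h1.trans h, h'.trans h3⟩, h''⟩, h, h'⟩
      · rintro ⟨⟨_, h''⟩, h⟩; exact ⟨h, h''⟩
    obtain ⟨c', d', k1, k2, k3, k4, k5⟩ := sierp_step f c d h2 hcl' h4 σ
    exact ⟨⟨(c', d'), h1.trans k1, k2, k3.trans h3, k4⟩, k1, k3, k5⟩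
  choose nx hn1 hn2 hn3 using step
  let s : ℕ → P := fun n => Nat.rec ⟨(a, b), le_rfl, hab, le_rfl, hne⟩ (fun k q => nx (u k) q) n
  have hs : ∀ n, s (n + 1) = nx (u n) (s n) := fun n => rfl
  have := IsCompact.nonempty_iInter_of_sequence_nonempty_isCompact_isClosed
    (fun n => Icc (s n).1.1 (s n).1.2)
    (fun n => by
      simp only [hs]
      exact Icc_subset_Icc (hn1 _ _) (hn2 _ _))
    (fun n => nonempty_Icc.2 (s n).2.2.1) isCompact_Icc (fun n => isClosed_Icc)
  obtain ⟨x, hx⟩ := this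
  obtain ⟨k, hk⟩ := hu (f x)
  have h := mem_iInter.1 hx (k + 1)
  simp only [hs] at h
  exact hn3 _ _ x h hk.symm

lemma ell1_split (f : Ell1) (n : ℕ) : ‖f‖ = |f n| + ‖f - lp.single 1 n (f n)‖ := by
  have h := lp.norm_sub_norm_compl_sub_single (p := 1) (by simp) f {n}
  simp at h
  linarith

def sgb (b : Bool) : ℝ := if b then 1 else -1

lemma sgb_sq (b : Bool) : sgb b * sgb b = 1 := by cases b <;> simp [sgb]
lemma sgb_abs (b : Bool) : |sgb b| = 1 := by cases b <;> simp [sgb]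

noncomputable def sv (i : ℕ × Bool) (c : ℝ) : Ell1 := lp.single 1 i.1 (sgb i.2 * c)

lemma sv_zero (i : ℕ × Bool) : sv i 0 = 0 := by simp [sv]

lemma sv_norm (i : ℕ × Bool) (c : ℝ) : ‖sv i c‖ = |c| := by
  rw [sv, lp.norm_single (by simp)]
  simp [abs_mul, sgb_abs]

lemma sv_sub (i : ℕ × Bool) (c d : ℝ) : sv i c - sv i d = sv i (c - d) := by
  rw [sv, sv, sv, mul_sub, lp.single_sub]

lemma sv_smul (i : ℕ × Bool) (a c : ℝ) : a • sv i c = sv i (a * c) := by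
  rw [sv, sv, ← lp.single_smul, smul_eq_mul]; congr 1; ring

lemma sv_dist_ne {i j : ℕ × Bool} (hij : i ≠ j) {c d : ℝ} (hc : 0 ≤ c) (hd : 0 ≤ d) :
    ‖sv i c - sv j d‖ = c + d := by
  obtain ⟨n, a⟩ := i
  obtain ⟨m, b⟩ := j
  by_cases hnm : n = m
  · subst hnm
    have hab : sgb b = - sgb a := by
      cases a <;> cases b <;> simp_all [sgb]
    rw [sv, sv, ← lp.single_sub, lp.norm_single (by simp)]
    simp only [hab]
    rw [show sgb a * c - -sgb a * d = sgb a * (c + d) by ring, Real.norm_eq_abs, abs_mul, sgb_abs,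
      abs_of_nonneg (by linarith)]
    ring
  · rw [ell1_split _ n]
    have h1 : (sv (n, a) c - sv (m, b) d) n = sgb a * c := by
      simp [sv, lp.single_apply, Pi.single_apply, hnm]
    rw [h1]
    have h2 : sv (n, a) c - sv (m, b) d - lp.single 1 n (sgb a * c) = - sv (m, b) d := by
      simp [sv]
    rw [h2, norm_neg, sv_norm, abs_mul, sgb_abs, abs_of_nonneg hc, abs_of_nonneg hd, one_mul]

lemma zmk_norm_sq (x : Ell1) (t : ℝ) : ‖zmk x t‖ ^ 2 = ‖x‖ ^ 2 + t ^ 2 := by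
  rw [WithLp.prod_norm_sq_eq_of_L2]; simp [zmk]

lemma zmk_sub (x y : Ell1) (t s : ℝ) : zmk x t - zmk y s = zmk (x - y) (t - s) := rfl
lemma zmk_smul (x : Ell1) (t a : ℝ) : a • zmk x t = zmk (a • x) (a * t) := rfl
lemma zmk_surj (z : Z) : ∃ x t, z = zmk x t := ⟨z.fst, z.snd, rfl⟩
lemma zmk_inj {x y : Ell1} {t s : ℝ} (h : zmk x t = zmk y s) : x = y ∧ t = s := by
  have h1 := congrArg WithLp.fst h
  have h2 := congrArg WithLp.snd h
  exact ⟨h1, h2⟩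

noncomputable def gg (i : ℕ × Bool) (θ : ℝ) : Z := zmk (sv i (Real.cos θ)) (Real.sin θ)

lemma gg_norm (i : ℕ × Bool) (θ : ℝ) : ‖gg i θ‖ = 1 := by
  have : ‖gg i θ‖ ^ 2 = 1 := by
    rw [gg, zmk_norm_sq, sv_norm, sq_abs]; exact Real.cos_sq_add_sin_sq θ
  nlinarith [norm_nonneg (gg i θ)]

lemma gg_dist_same (i : ℕ × Bool) (θ η : ℝ) :
    ‖gg i θ - gg i η‖ ^ 2 = 2 - 2 * Real.cos (θ - η) := by
  rw [gg, gg, zmk_sub, zmk_norm_sq, sv_sub, sv_norm, sq_abs, Real.cos_sub]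
  nlinarith [Real.cos_sq_add_sin_sq θ, Real.cos_sq_add_sin_sq η]

lemma cos_nn {θ : ℝ} (h : |θ| ≤ Real.pi / 2) : 0 ≤ Real.cos θ :=
  Real.cos_nonneg_of_mem_Icc (abs_le.1 h |>.imp (by intro h; linarith) id)

lemma gg_dist_ne {i j : ℕ × Bool} (hij : i ≠ j) {θ η : ℝ} (hθ : |θ| ≤ Real.pi / 2)
    (hη : |η| ≤ Real.pi / 2) :
    ‖gg i θ - gg j η‖ ^ 2 = 2 + 2 * Real.cos (θ + η) := by
  rw [gg, gg, zmk_sub, zmk_norm_sq, sv_dist_ne hij (cos_nn hθ) (cos_nn hη), Real.cos_add]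
  nlinarith [Real.cos_sq_add_sin_sq θ, Real.cos_sq_add_sin_sq η]

lemma gg_dist_le (i j : ℕ × Bool) {θ η : ℝ} (hθ : |θ| ≤ Real.pi / 2)
    (hη : |η| ≤ Real.pi / 2) :
    ‖gg i θ - gg j η‖ ^ 2 ≤ 2 + 2 * Real.cos (θ + η) := by
  by_cases hij : i = j
  · subst hij
    rw [gg_dist_same, Real.cos_sub, Real.cos_add]
    nlinarith [mul_nonneg (cos_nn hθ) (cos_nn hη)]
  · exact (gg_dist_ne hij hθ hη).le

lemma ell1_eq_of (y : Ell1) (i : ℕ × Bool) (h : ‖y‖ ≤ sgb i.2 * y i.1) : y = sv i ‖y‖ := by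
  have h1 := ell1_split y i.1
  have h2 : sgb i.2 * y i.1 ≤ |y i.1| := by
    calc _ ≤ |sgb i.2 * y i.1| := le_abs_self _
      _ = _ := by rw [abs_mul, sgb_abs, one_mul]
  have h3 : ‖y - lp.single 1 i.1 (y i.1)‖ = 0 := by
    have := norm_nonneg (y - lp.single 1 i.1 (y i.1))
    linarith
  have h4 : ‖y‖ = sgb i.2 * y i.1 := by
    rw [h3] at h1; linarith
  rw [sv]
  rw [h4]
  rw [← mul_assoc, sgb_sq, one_mul]
  exact sub_eq_zero.1 (norm_eq_zero.1 h3)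

lemma gg_ext (i : ℕ × Bool) {θ : ℝ} (hθ : |θ| ≤ Real.pi / 2) (z : Z) (a : ℝ)
    (h0 : 0 ≤ a) (h1 : a ≤ 1) (hz : ‖z‖ ≤ a) (hz' : ‖gg i θ - z‖ ≤ 1 - a) : z = a • gg i θ := by
  obtain ⟨y, τ, rfl⟩ := zmk_surj z
  have hc := cos_nn hθ
  have hcs := Real.cos_sq_add_sin_sq θ
  set c := Real.cos θ with hcdef
  set s := Real.sin θ with hsdef
  have e1 : ‖y‖ ^ 2 + τ ^ 2 ≤ a ^ 2 := by
    rw [← zmk_norm_sq]; gcongr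
  have e2 : ‖sv i c - y‖ ^ 2 + (s - τ) ^ 2 ≤ (1 - a) ^ 2 := by
    rw [← zmk_norm_sq, ← zmk_sub]
    exact pow_le_pow_left₀ (norm_nonneg _) hz' 2
  set w := sgb i.2 * y i.1 with hw
  have hwy : w ≤ ‖y‖ := by
    have h1 := ell1_split y i.1
    have := norm_nonneg (y - lp.single 1 i.1 (y i.1))
    calc w ≤ |w| := le_abs_self _
      _ = |y i.1| := by rw [hw, abs_mul, sgb_abs, one_mul]
      _ ≤ _ := by linarith
  have hwc : c - w ≤ ‖sv i c - y‖ := by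
    have h1 := ell1_split (sv i c - y) i.1
    have := norm_nonneg (sv i c - y - lp.single 1 i.1 ((sv i c - y) i.1))
    have h2 : (sv i c - y) i.1 = sgb i.2 * c - y i.1 := by simp [sv]
    have h3 : c - w = sgb i.2 * (sgb i.2 * c - y i.1) := by
      rw [mul_sub, ← mul_assoc, sgb_sq, one_mul]
    calc c - w ≤ |c - w| := le_abs_self _
      _ = |(sv i c - y) i.1| := by rw [h2, h3, abs_mul, sgb_abs, one_mul]
      _ ≤ _ := by linarith
  -- functional on the difference
  have cs : ∀ u v r : ℝ, 0 ≤ r → u ^ 2 + v ^ 2 ≤ r ^ 2 → c * u + s * v ≤ r := by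
    intro u v r hr h
    apply le_of_sq_le_sq _ hr
    nlinarith [sq_nonneg (c * v - s * u)]
  have k1 : c * ‖sv i c - y‖ + s * (s - τ) ≤ 1 - a := cs _ _ _ (by linarith) e2
  have k2 : a ≤ c * w + s * τ := by nlinarith
  have k3 : c * w ≤ c * ‖y‖ := mul_le_mul_of_nonneg_left hwy hc
  have k4 : c * ‖y‖ + s * τ ≤ a := cs _ _ _ h0 e1
  have k5 : (‖y‖ - a * c) ^ 2 + (τ - a * s) ^ 2 ≤ 0 := by nlinarith
  have k6 : ‖y‖ = a * c := by nlinarith [sq_nonneg (‖y‖ - a * c), sq_nonneg (τ - a * s)]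
  have k7 : τ = a * s := by nlinarith [sq_nonneg (‖y‖ - a * c), sq_nonneg (τ - a * s)]
  rw [gg, zmk_smul, sv_smul, ← hcdef, ← hsdef, ← k6, ← k7]
  congr 1
  rcases hc.eq_or_lt with hc0 | hc0
  · have : ‖y‖ = 0 := by rw [k6, ← hc0, mul_zero]
    rw [this, sv_zero]; exact norm_eq_zero.1 this
  · apply ell1_eq_of
    have : c * ‖y‖ ≤ c * w := by linarith
    exact le_of_mul_le_mul_left this hc0

lemma eq_gg_of_ext (G : Z) (hG : ‖G‖ = 1)
    (h : ∀ (U : Z) (a : ℝ), 0 ≤ a → a ≤ 1 → ‖U‖ ≤ a → ‖G - U‖ ≤ 1 - a → U = a • G) :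
    ∃ i θ, |θ| ≤ Real.pi / 2 ∧ G = gg i θ := by
  obtain ⟨y, s, rfl⟩ := zmk_surj G
  have e1 : ‖y‖ ^ 2 + s ^ 2 = 1 := by rw [← zmk_norm_sq, hG, one_pow]
  suffices H : ∃ i, y = sv i ‖y‖ by
    obtain ⟨i, hi⟩ := H
    refine ⟨i, Real.arcsin s, abs_le.2 ⟨?_, Real.arcsin_le_pi_div_two s⟩, ?_⟩
    · exact Real.neg_pi_div_two_le_arcsin s
    · have hs : -1 ≤ s ∧ s ≤ 1 := abs_le.1 ((sq_le_one_iff_abs_le_one s).1 (by nlinarith [sq_nonneg ‖y‖]))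
      rw [gg, Real.cos_arcsin, Real.sin_arcsin hs.1 hs.2, show 1 - s ^ 2 = ‖y‖ ^ 2 by linarith,
        Real.sqrt_sq (norm_nonneg _), ← hi]
  by_cases hy : y = 0
  · exact ⟨(0, true), by rw [hy, norm_zero, sv_zero]⟩
  obtain ⟨n, hn⟩ : ∃ n, y n ≠ 0 := by
    by_contra! H
    exact hy (by ext n; simpa using H n)
  have hy0 : 0 < ‖y‖ := norm_pos_iff.2 hy
  have sp := ell1_split y n
  have hp := norm_nonneg (y - lp.single 1 n (y n))
  set l := |y n| / ‖y‖ with hl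
  have hl0 : 0 < l := div_pos (abs_pos.2 hn) hy0
  have hl1 : l ≤ 1 := (div_le_one hy0).2 (by linarith)
  have hly : |y n| = l * ‖y‖ := by rw [hl]; field_simp
  have hU := h (zmk (lp.single 1 n (y n)) (l * s)) l hl0.le hl1
    (by
      apply le_of_sq_le_sq _ hl0.le
      rw [zmk_norm_sq, lp.norm_single (by simp), Real.norm_eq_abs, hly]
      nlinarith)
    (by
      apply le_of_sq_le_sq _ (by linarith)
      rw [zmk_sub, zmk_norm_sq, show ‖y - lp.single 1 n (y n)‖ = (1 - l) * ‖y‖ by linarith]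
      nlinarith)
  rw [zmk_smul] at hU
  have hU1 := (zmk_inj hU).1
  have hyn : y n = l * y n := by
    have := congrArg (fun f : Ell1 => f n) hU1
    simpa using this
  have hl2 : l = 1 := by
    have : (1 - l) * y n = 0 := by linarith
    rcases mul_eq_zero.1 this with h | h
    · linarith
    · exact absurd h hn
  rw [hl2, one_mul] at hly
  refine ⟨(n, decide (0 < y n)), ell1_eq_of _ _ ?_⟩
  rw [← hly]
  by_cases hpos : 0 < y n
  · simp [sgb, hpos, abs_of_pos]
  · simp [sgb, hpos, abs_of_nonpos (not_lt.1 hpos)]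

lemma abs_le_of_cos_le {A B : ℝ} (hA : |A| ≤ Real.pi) (_ : |B| ≤ Real.pi)
    (h : Real.cos B ≤ Real.cos A) : |A| ≤ |B| := by
  by_contra! H
  have := Real.cos_lt_cos_of_nonneg_of_le_pi (abs_nonneg B) hA H
  rw [Real.cos_abs, Real.cos_abs] at this
  linarith

lemma gg_cont (i : ℕ × Bool) : Continuous (gg i) := by
  have h : LipschitzWith 1 (gg i) := by
    apply LipschitzWith.of_dist_le_mul
    intro x y
    rw [dist_eq_norm, NNReal.coe_one, one_mul, Real.dist_eq]
    apply le_of_sq_le_sq _ (abs_nonneg _)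
    rw [gg_dist_same, sq_abs]
    have := Real.one_sub_sq_div_two_le_cos (x := x - y)
    linarith
  exact h.continuous

lemma gg_idx {i j : ℕ × Bool} {θ : ℝ} (hθ : |θ| < Real.pi / 2) (h : gg i θ = gg j θ) : i = j := by
  by_contra hij
  have h1 := gg_dist_ne hij hθ.le hθ.le
  have hc : 0 < Real.cos θ := Real.cos_pos_of_mem_Ioo (abs_lt.1 hθ |>.imp (by intro h; linarith) id)
  rw [h, sub_self, norm_zero, Real.cos_add] at h1
  nlinarith [Real.cos_sq_add_sin_sq θ]

lemma gg_top (i : ℕ × Bool) : gg i (Real.pi / 2) = zmk 0 1 := by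
  rw [gg, Real.cos_pi_div_two, Real.sin_pi_div_two, sv_zero]

lemma gg_bot (i : ℕ × Bool) : gg i (-(Real.pi / 2)) = zmk 0 (-1) := by
  rw [gg, Real.cos_neg, Real.sin_neg, Real.cos_pi_div_two, Real.sin_pi_div_two, sv_zero]

lemma preimage_gg (F : Z → Z) (hbij : Set.BijOn F (Metric.closedBall 0 1) (Metric.closedBall 0 1))
    (hd : ∀ x y : Z, ‖x‖ ≤ 1 → ‖y‖ ≤ 1 → ‖F x - F y‖ ≤ ‖x - y‖)
    (i : ℕ × Bool) (θ : ℝ) (hθ : |θ| ≤ Real.pi / 2) :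
    ∃ (j : ℕ × Bool) (η : ℝ), |η| ≤ Real.pi / 2 ∧ F (gg j η) = gg i θ := by
  have hmem : ∀ z : Z, z ∈ Metric.closedBall (0 : Z) 1 ↔ ‖z‖ ≤ 1 := fun z => by simp
  have hF0 : F 0 = 0 := by
    by_contra h0
    have hp : 0 < ‖F 0‖ := norm_pos_iff.2 h0
    obtain ⟨u, hu, hFu⟩ := hbij.surjOn ((hmem (-(‖F 0‖⁻¹ • F 0))).2 (by
      rw [norm_neg, norm_smul, norm_inv, norm_norm, inv_mul_cancel₀ hp.ne']))
    have h := hd u 0 ((hmem u).1 hu) (by simp)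
    rw [hFu, sub_zero, ← neg_add', norm_neg,
      show ‖F 0‖⁻¹ • F 0 + F 0 = (‖F 0‖⁻¹ + 1) • F 0 by rw [add_smul, one_smul], norm_smul,
      Real.norm_of_nonneg (by positivity), add_mul, inv_mul_cancel₀ hp.ne'] at h
    linarith [(hmem u).1 hu]
  have hFn : ∀ u : Z, ‖u‖ ≤ 1 → ‖F u‖ ≤ ‖u‖ := fun u hu => by
    simpa [hF0] using hd u 0 hu (by simp)
  obtain ⟨G, hG, hFG⟩ := hbij.surjOn ((hmem (gg i θ)).2 (gg_norm i θ).le)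
  rw [hmem] at hG
  have hG1 : ‖G‖ = 1 := by
    have := hFn G hG
    rw [hFG, gg_norm] at this
    linarith
  have key : ∀ (U : Z) (a : ℝ), 0 ≤ a → a ≤ 1 → ‖U‖ ≤ a → ‖G - U‖ ≤ 1 - a →
      F U = a • gg i θ := by
    intro U a h0 h1 hU hGU
    refine gg_ext i hθ _ a h0 h1 ((hFn U (hU.trans h1)).trans hU) ?_
    rw [← hFG]
    exact (hd G U hG (hU.trans h1)).trans hGU
  obtain ⟨j, η, hη, rfl⟩ := eq_gg_of_ext G hG1 (by
    intro U a h0 h1 hU hGU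
    have hn : ‖a • G‖ = a := by rw [norm_smul, hG1, mul_one, Real.norm_of_nonneg h0]
    have hn' : ‖G - a • G‖ = 1 - a := by
      rw [show G - a • G = (1 - a) • G by rw [sub_smul, one_smul], norm_smul, hG1, mul_one,
        Real.norm_of_nonneg (by linarith)]
    refine hbij.injOn ((hmem _).2 (hU.trans h1)) ((hmem _).2 (hn.le.trans h1)) ?_
    rw [key U a h0 h1 hU hGU, key _ a h0 h1 hn.le hn'.le])
  exact ⟨j, η, hη, hFG⟩

/-- If F is a non-expansive bijection of the closed unit ball of Z = ℓ₁ ⊕₂ ℝ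
onto itself, then F(0, 1) = (0, 1) or F(0, 1) = (0, -1). -/
theorem image_of_top_vertex_ell1_sum2_real
    (B : Set Z) (hB : B = Metric.closedBall (0 : Z) 1)
    (F : Z → Z) (hbij : Set.BijOn F B B) (hne : LipschitzOnWith 1 F B) :
    F (zmk 0 1) = zmk 0 1 ∨ F (zmk 0 1) = zmk 0 (-1) := by
  subst hB
  have hmem : ∀ z : Z, z ∈ Metric.closedBall (0 : Z) 1 ↔ ‖z‖ ≤ 1 := fun z => by simp
  have hgm : ∀ i θ, gg i θ ∈ Metric.closedBall (0 : Z) 1 := fun i θ => (hmem _).2 (gg_norm i θ).le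
  have hd : ∀ x y : Z, ‖x‖ ≤ 1 → ‖y‖ ≤ 1 → ‖F x - F y‖ ≤ ‖x - y‖ := by
    intro x y hx hy
    simpa [dist_eq_norm] using hne.dist_le_mul x ((hmem x).2 hx) y ((hmem y).2 hy)
  have hpi := Real.pi_pos
  choose! κ τ hτ hF using preimage_gg F hbij hd
  -- different indices
  have hdiff : ∀ i j, i ≠ j → ∀ θ η, |θ| ≤ Real.pi / 2 → |η| ≤ Real.pi / 2 →
      |τ i θ + τ j η| ≤ |θ + η| := by
    intro i j hij θ η hθ hη
    have h1 := hd (gg (κ i θ) (τ i θ)) (gg (κ j η) (τ j η)) (gg_norm _ _).le (gg_norm _ _).le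
    rw [hF i θ hθ, hF j η hη] at h1
    have h2 := pow_le_pow_left₀ (norm_nonneg _) h1 2
    rw [gg_dist_ne hij hθ hη] at h2
    have h3 := h2.trans (gg_dist_le (κ i θ) (κ j η) (hτ i θ hθ) (hτ j η hη))
    apply abs_le_of_cos_le _ _ (by linarith)
    · linarith [abs_add_le (τ i θ) (τ j η), hτ i θ hθ, hτ j η hη]
    · linarith [abs_add_le θ η]
  have hneg : ∀ i j, i ≠ j → ∀ θ, |θ| ≤ Real.pi / 2 → τ j (-θ) = - τ i θ := by
    intro i j hij θ hθ
    have := hdiff i j hij θ (-θ) hθ (by rwa [abs_neg])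
    rw [add_neg_cancel, abs_zero] at this
    linarith [abs_nonpos_iff.1 this]
  let o : ℕ × Bool := (0, true)
  have hodd : ∀ θ, |θ| ≤ Real.pi / 2 → τ o (-θ) = - τ o θ := by
    intro θ hθ
    have hθ' : |-θ| ≤ Real.pi / 2 := by rwa [abs_neg]
    have h1 := hneg o (1, true) (by simp [o]) θ hθ
    have h2 := hneg (1, true) (2, true) (by simp) (-θ) hθ'
    have h3 := hneg (2, true) o (by simp [o]) θ hθ
    rw [neg_neg] at h2
    linarith
  have hlip : ∀ θ η, |θ| ≤ Real.pi / 2 → |η| ≤ Real.pi / 2 → |τ o θ - τ o η| ≤ |θ - η| := by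
    intro θ η hθ hη
    have h1 := hneg o (1, true) (by simp [o]) η hη
    have := hdiff o (1, true) (by simp [o]) θ (-η) hθ (by rwa [abs_neg])
    rwa [h1, ← sub_eq_add_neg, ← sub_eq_add_neg] at this
  have hzero : τ o 0 = 0 := by
    have := hodd 0 (by rw [abs_zero]; positivity)
    rw [neg_zero] at this; linarith
  have hle : ∀ θ, |θ| ≤ Real.pi / 2 → |τ o θ| ≤ |θ| := by
    intro θ hθ
    have := hlip θ 0 hθ (by rw [abs_zero]; positivity)
    simpa [hzero] using this
  have hconst : ∀ θ, 0 ≤ θ → θ < Real.pi / 2 → κ o (-θ) = κ o θ := by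
    intro θ h0 h1
    apply sierp (κ o) (-θ) θ (by linarith)
    intro σ
    apply IsSeqClosed.isClosed
    intro x l hx hxl
    have hlI : l ∈ Icc (-θ) θ := isClosed_Icc.isSeqClosed (fun n => (hx n).1) hxl
    have habs : ∀ y ∈ Icc (-θ) θ, |y| < Real.pi / 2 := fun y hy =>
      (abs_le.2 hy).trans_lt h1
    refine ⟨hlI, ?_⟩
    have hτl : Filter.Tendsto (fun n => τ o (x n)) Filter.atTop (nhds (τ o l)) := by
      rw [tendsto_iff_dist_tendsto_zero] at hxl ⊢
      refine squeeze_zero (fun n => dist_nonneg) (fun n => ?_) hxl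
      rw [Real.dist_eq, Real.dist_eq]
      exact hlip _ _ (habs _ (hx n).1).le (habs _ hlI).le
    have ht1 : Filter.Tendsto (fun n => gg σ (τ o (x n))) Filter.atTop (nhds (gg σ (τ o l))) :=
      ((gg_cont σ).tendsto _).comp hτl
    have ht2 : Filter.Tendsto (fun n => F (gg σ (τ o (x n)))) Filter.atTop
        (nhds (F (gg σ (τ o l)))) := by
      rw [tendsto_iff_dist_tendsto_zero] at ht1 ⊢
      refine squeeze_zero (fun n => dist_nonneg) (fun n => ?_) ht1
      rw [dist_eq_norm, dist_eq_norm]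
      exact hd _ _ (gg_norm _ _).le (gg_norm _ _).le
    have ht3 : Filter.Tendsto (fun n => F (gg σ (τ o (x n)))) Filter.atTop (nhds (gg o l)) := by
      have : (fun n => F (gg σ (τ o (x n)))) = fun n => gg o (x n) := by
        funext n
        rw [← (hx n).2]
        exact hF o _ (habs _ (hx n).1).le
      rw [this]
      exact ((gg_cont o).tendsto _).comp hxl
    have he := tendsto_nhds_unique ht2 ht3
    rw [← hF o l (habs _ hlI).le] at he
    have he' := hbij.injOn (hgm _ _) (hgm _ _) he
    exact (gg_idx ((hle l (habs _ hlI).le).trans_lt (habs _ hlI)) he').symm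
  have hbig : ∀ θ, 0 ≤ θ → θ < Real.pi / 2 → θ ≤ |τ o θ| := by
    intro θ h0 h1
    have ha : |θ| ≤ Real.pi / 2 := by rw [abs_of_nonneg h0]; exact h1.le
    have ha' : |-θ| ≤ Real.pi / 2 := by rwa [abs_neg]
    have k1 := hd (gg (κ o θ) (τ o θ)) (gg (κ o (-θ)) (τ o (-θ))) (gg_norm _ _).le (gg_norm _ _).le
    rw [hF o θ ha, hF o (-θ) ha', hconst θ h0 h1] at k1
    have k2 := pow_le_pow_left₀ (norm_nonneg _) k1 2
    rw [gg_dist_same, gg_dist_same, hodd θ ha, sub_neg_eq_add, sub_neg_eq_add] at k2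
    have k3 := abs_le_of_cos_le (A := θ + θ) (B := τ o θ + τ o θ)
      (by rw [abs_of_nonneg (by linarith)]; linarith)
      (by linarith [abs_add_le (τ o θ) (τ o θ), hτ o θ ha]) (by linarith)
    rw [abs_of_nonneg (by linarith)] at k3
    linarith [abs_add_le (τ o θ) (τ o θ)]
  have hp2 : |Real.pi / 2| ≤ Real.pi / 2 := by rw [abs_of_nonneg (by linarith)]
  have hfin : Real.pi / 2 ≤ |τ o (Real.pi / 2)| := by
    by_contra! H
    set q := |τ o (Real.pi / 2)|
    have hq : 0 ≤ q := abs_nonneg _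
    let θ := (Real.pi / 2) - (Real.pi / 2 - q) / 4
    have h0 : 0 ≤ θ := by simp only [θ]; linarith
    have h1 : θ < Real.pi / 2 := by simp only [θ]; linarith
    have h2 := hbig θ h0 h1
    have h3 := hlip θ (Real.pi / 2) (by rw [abs_of_nonneg h0]; exact h1.le) hp2
    have h4 := abs_sub_abs_le_abs_sub (τ o θ) (τ o (Real.pi / 2))
    rw [abs_sub_comm θ, abs_of_nonneg (by linarith : 0 ≤ Real.pi / 2 - θ)] at h3
    simp only [θ] at *
    linarith
  have hFp := hF o (Real.pi / 2) hp2
  have heq : |τ o (Real.pi / 2)| = Real.pi / 2 := le_antisymm (hτ o _ hp2) hfin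
  rcases (abs_eq (by positivity)).1 heq with h | h
  · left
    rwa [h, gg_top, gg_top] at hFp
  · right
    rw [h, gg_bot, gg_top] at hFp
    -- F(-e) = e, so the preimage of -e is also extreme with angle π/2
    have hm2 : |-(Real.pi / 2)| ≤ Real.pi / 2 := by rwa [abs_neg]
    have h5 := hF o (-(Real.pi / 2)) hm2
    rwa [hodd _ hp2, h, neg_neg, gg_top, gg_bot] at h5
end

section
/- Let X and Y be nontrivial strictly convex real Banach spaces, let Z = X ⊕_∞ Y, let E = { z ∈ B_Z : ‖z_x‖ = ‖z_y‖ } (where z_x and z_y are the X- and Y-components of z), and let F : B_Z → B_Z be a non-expansive bijection of the closed unit ball onto itself. Then F(E) = E. -/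
theorem aux_dist2 {X : Type*} [NormedAddCommGroup X] [NormedSpace ℝ X] [StrictConvexSpace ℝ X]
    {a b : X} (ha : ‖a‖ ≤ 1) (hb : ‖b‖ ≤ 1) (h : 2 ≤ ‖a - b‖) : b = -a ∧ ‖a‖ = 1 := by
  have h1 := norm_sub_le a b
  have ha1 : ‖a‖ = 1 := by linarith
  have hb1 : ‖b‖ = 1 := by linarith
  have h2 : a = -b := by
    apply eq_of_norm_eq_of_norm_add_eq
    · rw [norm_neg, ha1, hb1]
    · rw [← sub_eq_add_neg, norm_neg]; linarith
  exact ⟨by rw [h2, neg_neg], ha1⟩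

theorem aux_pair {X Y : Type*} [NormedAddCommGroup X] [NormedSpace ℝ X] [StrictConvexSpace ℝ X]
    [NormedAddCommGroup Y] [NormedSpace ℝ Y] [StrictConvexSpace ℝ Y]
    {z w : X × Y} (hz : ‖z‖ ≤ 1) (hw : ‖w‖ ≤ 1) (h : 2 ≤ ‖z - w‖) :
    (w.1 = -z.1 ∧ ‖z.1‖ = 1) ∨ (w.2 = -z.2 ∧ ‖z.2‖ = 1) := by
  rw [Prod.norm_def] at h
  rcases le_max_iff.1 h with h | h
  · exact Or.inl (aux_dist2 ((norm_fst_le z).trans hz) ((norm_fst_le w).trans hw) h)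
  · exact Or.inr (aux_dist2 ((norm_snd_le z).trans hz) ((norm_snd_le w).trans hw) h)

theorem aux_neg {X : Type*} [NormedAddCommGroup X] [NormedSpace ℝ X] {a : X}
    (h : a = -a) (h1 : ‖a‖ = 1) : False := by
  have h2 : (2:ℝ) • a = 0 := by
    rw [two_smul]; nth_rewrite 1 [h]; exact neg_add_cancel a
  have : a = 0 := (smul_eq_zero.1 h2).resolve_left two_ne_zero
  simp [this] at h1

theorem aux_four {X Y : Type*} [NormedAddCommGroup X] [NormedSpace ℝ X]
    [NormedAddCommGroup Y] [NormedSpace ℝ Y]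
    {z v₁ v₂ v₃ : X × Y}
    (h1 : (v₁.1 = -z.1 ∧ ‖z.1‖ = 1) ∨ (v₁.2 = -z.2 ∧ ‖z.2‖ = 1))
    (h2 : (v₂.1 = -z.1 ∧ ‖z.1‖ = 1) ∨ (v₂.2 = -z.2 ∧ ‖z.2‖ = 1))
    (h3 : (v₃.1 = -z.1 ∧ ‖z.1‖ = 1) ∨ (v₃.2 = -z.2 ∧ ‖z.2‖ = 1))
    (h12 : (v₂.1 = -v₁.1 ∧ ‖v₁.1‖ = 1) ∨ (v₂.2 = -v₁.2 ∧ ‖v₁.2‖ = 1))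
    (h13 : (v₃.1 = -v₁.1 ∧ ‖v₁.1‖ = 1) ∨ (v₃.2 = -v₁.2 ∧ ‖v₁.2‖ = 1))
    (h23 : (v₃.1 = -v₂.1 ∧ ‖v₂.1‖ = 1) ∨ (v₃.2 = -v₂.2 ∧ ‖v₂.2‖ = 1)) :
    ‖z.1‖ = 1 ∧ ‖z.2‖ = 1 := by
  constructor
  · by_contra hc
    have h1 := h1.resolve_left (fun h => hc h.2)
    have h2 := h2.resolve_left (fun h => hc h.2)
    have h3 := h3.resolve_left (fun h => hc h.2)
    have h12 := h12.resolve_right (fun h => aux_neg (h1.1.trans (h2.1.symm.trans h.1)) h.2)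
    have h13 := h13.resolve_right (fun h => aux_neg (h1.1.trans (h3.1.symm.trans h.1)) h.2)
    have h23 := h23.resolve_right (fun h => aux_neg (h2.1.trans (h3.1.symm.trans h.1)) h.2)
    exact aux_neg (h12.1.trans (h13.1.symm.trans h23.1)) h23.2
  · by_contra hc
    have h1 := h1.resolve_right (fun h => hc h.2)
    have h2 := h2.resolve_right (fun h => hc h.2)
    have h3 := h3.resolve_right (fun h => hc h.2)
    have h12 := h12.resolve_left (fun h => aux_neg (h1.1.trans (h2.1.symm.trans h.1)) h.2)
    have h13 := h13.resolve_left (fun h => aux_neg (h1.1.trans (h3.1.symm.trans h.1)) h.2)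
    have h23 := h23.resolve_left (fun h => aux_neg (h2.1.trans (h3.1.symm.trans h.1)) h.2)
    exact aux_neg (h12.1.trans (h13.1.symm.trans h23.1)) h23.2

/-- a unit vector decomposed with small pieces -/
theorem aux_ext {X : Type*} [NormedAddCommGroup X] [NormedSpace ℝ X] [StrictConvexSpace ℝ X]
    {e p : X} {s : ℝ} (he : ‖e‖ = 1) (hp : ‖p‖ ≤ s) (hq : ‖p - e‖ ≤ 1 - s) : p = s • e := by
  have h0 : 0 ≤ s := (norm_nonneg p).trans hp
  have h1 : 0 ≤ 1 - s := (norm_nonneg _).trans hq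
  have h2 : dist (0:X) p = s * dist (0:X) e ∧ dist p e = (1 - s) * dist (0:X) e := by
    have := norm_sub_le p (p - e)
    rw [sub_sub_cancel, he] at this
    rw [dist_zero_left, dist_zero_left, dist_eq_norm, he]
    constructor <;> linarith
  have := eq_lineMap_of_dist_eq_mul_of_dist_eq_mul h2.1 h2.2
  rw [this]; simp [AffineMap.lineMap_apply]

theorem aux_not_seg {X : Type*} [NormedAddCommGroup X] [NormedSpace ℝ X]
    {a c : X} (ha : a ≠ 0) (hc : c ≠ 0) :
    (0 : X) ∉ segment ℝ a c ∨ (0 : X) ∉ segment ℝ a (-c) := by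
  by_contra! h
  have h1 := sameRay_of_mem_segment h.1
  have h2 := sameRay_of_mem_segment h.2
  simp only [zero_sub, sub_zero, sameRay_neg_iff] at h1 h2
  have h1' : SameRay ℝ a (-c) := by
    rw [← sameRay_neg_iff, neg_neg]; exact h1
  have h2' : SameRay ℝ a c := h2
  have h3 : SameRay ℝ c (-c) := h2'.symm.trans h1' (fun h => absurd h ha)
  exact hc (eq_zero_of_sameRay_self_neg h3)

theorem image_of_diagonal_set_linf_sum_strictly_convex
    (X Y : Type*) [NormedAddCommGroup X] [NormedSpace ℝ X] [CompleteSpace X]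
    [NormedAddCommGroup Y] [NormedSpace ℝ Y] [CompleteSpace Y]
    [StrictConvexSpace ℝ X] [StrictConvexSpace ℝ Y]
    [Nontrivial X] [Nontrivial Y]
    (B : Set (X × Y)) (hB : B = Metric.closedBall (0 : X × Y) 1)
    (E : Set (X × Y)) (hE : E = {z ∈ B | ‖z.1‖ = ‖z.2‖})
    (F : X × Y → X × Y) (hbij : Set.BijOn F B B) (hne : LipschitzOnWith 1 F B) :
    F '' E = E := by
  have mB : ∀ z : X × Y, z ∈ B ↔ ‖z‖ ≤ 1 := by intro z; rw [hB]; simp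
  have mB2 : ∀ z : X × Y, z ∈ B ↔ ‖z.1‖ ≤ 1 ∧ ‖z.2‖ ≤ 1 := by
    intro z; rw [mB, Prod.norm_def, max_le_iff]
  have mE : ∀ z : X × Y, z ∈ E ↔ z ∈ B ∧ ‖z.1‖ = ‖z.2‖ := by intro z; rw [hE]; rfl
  have conv : Convex ℝ B := by rw [hB]; exact convex_closedBall _ _
  have lip : ∀ z ∈ B, ∀ w ∈ B, ‖F z - F w‖ ≤ ‖z - w‖ := by
    intro z hz w hw
    have := hne.dist_le_mul z hz w hw
    simpa [dist_eq_norm] using this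
  have h0B : (0 : X × Y) ∈ B := by rw [mB]; simp
  obtain ⟨x₀, hx₀⟩ : ∃ x : X, ‖x‖ = 1 := exists_norm_eq X zero_le_one
  obtain ⟨y₀, hy₀⟩ : ∃ y : Y, ‖y‖ = 1 := exists_norm_eq Y zero_le_one
  -- F 0 = 0
  have F0 : F 0 = 0 := by
    by_contra hne0
    set a := F 0 with ha
    have hna : 0 < ‖a‖ := norm_pos_iff.2 hne0
    obtain ⟨w, hw, hwa⟩ := hbij.surjOn (show (-(‖a‖⁻¹ • a)) ∈ B by
      rw [mB, norm_neg, norm_smul, norm_inv, norm_norm, inv_mul_cancel₀ hna.ne'])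
    have h1 := lip w hw 0 h0B
    rw [hwa, ← ha, sub_zero] at h1
    have h2 : -(‖a‖⁻¹ • a) - a = -((‖a‖⁻¹ + 1) • a) := by rw [add_smul, one_smul]; abel
    rw [h2, norm_neg, norm_smul, Real.norm_of_nonneg (by positivity), add_mul,
      inv_mul_cancel₀ hna.ne'] at h1
    have := (mB w).1 hw
    linarith
  have Fn : ∀ z ∈ B, ‖F z‖ ≤ ‖z‖ := by
    intro z hz
    have := lip z hz 0 h0B
    simpa [F0] using this
  have pr : ∀ z ∈ B, ∀ w ∈ B, 2 ≤ ‖F z - F w‖ →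
      (w.1 = -z.1 ∧ ‖z.1‖ = 1) ∨ (w.2 = -z.2 ∧ ‖z.2‖ = 1) := by
    intro z hz w hw h
    exact aux_pair ((mB z).1 hz) ((mB w).1 hw) (h.trans (lip z hz w hw))
  have two1 : ∀ a : X, ‖a‖ = 1 → ‖a - -a‖ = 2 ∧ ‖-a - a‖ = 2 := by
    intro a ha
    have h : ‖a - -a‖ = 2 := by
      rw [sub_neg_eq_add, ← two_smul ℝ a, norm_smul, ha]; norm_num
    exact ⟨h, by rw [norm_sub_rev]; exact h⟩
  have two2 : ∀ a : Y, ‖a‖ = 1 → ‖a - -a‖ = 2 ∧ ‖-a - a‖ = 2 := by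
    intro a ha
    have h : ‖a - -a‖ = 2 := by
      rw [sub_neg_eq_add, ← two_smul ℝ a, norm_smul, ha]; norm_num
    exact ⟨h, by rw [norm_sub_rev]; exact h⟩
  -- preimages of extreme points are extreme
  have pext : ∀ u ∈ B, ‖(F u).1‖ = 1 → ‖(F u).2‖ = 1 → ‖u.1‖ = 1 ∧ ‖u.2‖ = 1 := by
    intro u hu h1 h2
    obtain ⟨v₁, hv₁, e₁⟩ := hbij.surjOn (show (-(F u).1, (F u).2) ∈ B by rw [mB2]; simp [h1, h2])
    obtain ⟨v₂, hv₂, e₂⟩ := hbij.surjOn (show ((F u).1, -(F u).2) ∈ B by rw [mB2]; simp [h1, h2])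
    obtain ⟨v₃, hv₃, e₃⟩ := hbij.surjOn (show (-(F u).1, -(F u).2) ∈ B by rw [mB2]; simp [h1, h2])
    have t1 := two1 _ h1
    have t2 := two2 _ h2
    refine aux_four (pr u hu v₁ hv₁ ?_) (pr u hu v₂ hv₂ ?_) (pr u hu v₃ hv₃ ?_)
      (pr v₁ hv₁ v₂ hv₂ ?_) (pr v₁ hv₁ v₃ hv₃ ?_) (pr v₂ hv₂ v₃ hv₃ ?_)
    · rw [e₁]; exact t1.1.ge.trans (norm_fst_le (F u - (-(F u).1, (F u).2)))
    · rw [e₂]; exact t2.1.ge.trans (norm_snd_le (F u - ((F u).1, -(F u).2)))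
    · rw [e₃]; exact t2.1.ge.trans (norm_snd_le (F u - (-(F u).1, -(F u).2)))
    · rw [e₁, e₂, Prod.norm_def]; exact t1.2.ge.trans (le_max_left _ _)
    · rw [e₁, e₃, Prod.norm_def]; exact t2.1.ge.trans (le_max_right _ _)
    · rw [e₂, e₃, Prod.norm_def]; exact t1.1.ge.trans (le_max_left _ _)
  have homog : ∀ u ∈ B, ‖(F u).1‖ = 1 → ‖(F u).2‖ = 1 → ∀ s : ℝ, 0 ≤ s → s ≤ 1 →
      s • u ∈ B ∧ F (s • u) = s • F u := by
    intro u hu h1 h2 s hs0 hs1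
    have hu1 := (mB u).1 hu
    have hsn : ‖s • u‖ ≤ s := by
      rw [norm_smul, Real.norm_of_nonneg hs0]; nlinarith
    have hsB : s • u ∈ B := by rw [mB]; linarith
    have n1 := (Fn _ hsB).trans hsn
    have n2 : ‖F (s • u) - F u‖ ≤ 1 - s := by
      refine (lip _ hsB _ hu).trans ?_
      rw [show s • u - u = -((1 - s) • u) by rw [sub_smul, one_smul]; abel, norm_neg, norm_smul,
        Real.norm_of_nonneg (by linarith)]
      nlinarith
    refine ⟨hsB, Prod.ext ?_ ?_⟩
    · exact aux_ext h1 ((norm_fst_le _).trans n1) ((norm_fst_le (F (s • u) - F u)).trans n2)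
    · exact aux_ext h2 ((norm_snd_le _).trans n1) ((norm_snd_le (F (s • u) - F u)).trans n2)
  -- preimage of E is in E
  have preE : ∀ z ∈ B, F z ∈ E → z ∈ E := by
    intro z hz hFz
    obtain ⟨hFB, heq⟩ := (mE _).1 hFz
    by_cases hr : ‖(F z).1‖ = 0
    · have : F z = F 0 := by
        rw [F0]; exact Prod.ext (norm_eq_zero.1 hr) (norm_eq_zero.1 (heq ▸ hr))
      rw [hbij.injOn hz h0B this, mE]; exact ⟨h0B, by simp⟩
    · set r := ‖(F z).1‖ with hrd
      have hr0 : 0 < r := lt_of_le_of_ne (norm_nonneg _) (Ne.symm hr)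
      have hr1 : r ≤ 1 := ((mB2 _).1 hFB).1
      have n1 : ‖r⁻¹ • (F z).1‖ = 1 := by
        rw [norm_smul, norm_inv, Real.norm_of_nonneg hr0.le, ← hrd, inv_mul_cancel₀ hr]
      have n2 : ‖r⁻¹ • (F z).2‖ = 1 := by
        rw [norm_smul, norm_inv, Real.norm_of_nonneg hr0.le, ← heq, inv_mul_cancel₀ hr]
      obtain ⟨u, hu, hFu⟩ := hbij.surjOn (show r⁻¹ • F z ∈ B by
        rw [mB2]; exact ⟨n1.le, n2.le⟩)
      have m1 : ‖(F u).1‖ = 1 := by rw [hFu]; exact n1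
      have m2 : ‖(F u).2‖ = 1 := by rw [hFu]; exact n2
      obtain ⟨q1, q2⟩ := homog u hu m1 m2 r hr0.le hr1
      rw [hFu, smul_inv_smul₀ hr] at q2
      obtain ⟨p1, p2⟩ := pext u hu m1 m2
      rw [← hbij.injOn q1 hz q2, mE]
      refine ⟨q1, ?_⟩
      rw [Prod.smul_fst, Prod.smul_snd, norm_smul, norm_smul, p1, p2]
  -- sign function
  set φ : X × Y → ℝ := fun z => ‖(F z).1‖ - ‖(F z).2‖ with hφ
  have φc : ContinuousOn φ B := by
    have := hne.continuousOn
    exact (continuous_fst.comp_continuousOn this).norm.sub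
      (continuous_snd.comp_continuousOn this).norm
  have φE : ∀ z ∈ B, φ z = 0 → z ∈ E := by
    intro z hz h
    exact preE z hz ((mE _).2 ⟨hbij.mapsTo hz, sub_eq_zero.1 h⟩)
  have seg : ∀ p ∈ B, ∀ q ∈ B, (∀ z ∈ segment ℝ p q, φ z ≠ 0) → (0 < φ p ↔ 0 < φ q) := by
    intro p hp q hq hz
    have hs : segment ℝ p q ⊆ B := conv.segment_subset hp hq
    have pc : IsPreconnected (segment ℝ p q) := (convex_segment p q).isPreconnected
    have key : ∀ a ∈ segment ℝ p q, ∀ b ∈ segment ℝ p q, 0 < φ a → 0 < φ b := by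
      intro a ha b hb h
      by_contra hb'
      obtain ⟨z, hz1, hz2⟩ := pc.intermediate_value hb ha (φc.mono hs) ⟨not_lt.1 hb', h.le⟩
      exact hz z hz1 hz2
    exact ⟨key _ (left_mem_segment ..) _ (right_mem_segment ..),
      key _ (right_mem_segment ..) _ (left_mem_segment ..)⟩
  have V1 : ∀ z ∈ B, φ z ≠ 0 → z.1 ≠ 0 → ‖z.2‖ ≤ ‖z.1‖ →
      ((z.1, (0:Y)) ∈ B ∧ (0 < φ z ↔ 0 < φ (z.1, 0))) := by
    intro z hz hφz hne h
    have hB0 : (z.1, (0:Y)) ∈ B := by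
      rw [mB2] at hz ⊢; exact ⟨hz.1, by simp⟩
    refine ⟨hB0, seg _ hz _ hB0 ?_⟩
    rintro w ⟨s, t, hs, ht, hst, rfl⟩ h0
    have hw := φE _ (conv hz hB0 hs ht hst) h0
    have h2 := ((mE _).1 hw).2
    have e1 : (s • z + t • (z.1, (0:Y))).1 = z.1 := by
      simp [← add_smul, hst]
    have e2 : (s • z + t • (z.1, (0:Y))).2 = s • z.2 := by simp
    rw [e1, e2, norm_smul, Real.norm_of_nonneg hs] at h2
    have hp : 0 < ‖z.1‖ := norm_pos_iff.2 hne
    have hs1 : s = 1 := by nlinarith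
    have ht0 : t = 0 := by linarith
    subst hs1 ht0
    simp at h0
    exact hφz h0
  have V2 : ∀ z ∈ B, φ z ≠ 0 → z.2 ≠ 0 → ‖z.1‖ ≤ ‖z.2‖ →
      (((0:X), z.2) ∈ B ∧ (0 < φ z ↔ 0 < φ (0, z.2))) := by
    intro z hz hφz hne h
    have hB0 : ((0:X), z.2) ∈ B := by
      rw [mB2] at hz ⊢; exact ⟨by simp, hz.2⟩
    refine ⟨hB0, seg _ hz _ hB0 ?_⟩
    rintro w ⟨s, t, hs, ht, hst, rfl⟩ h0
    have hw := φE _ (conv hz hB0 hs ht hst) h0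
    have h2 := ((mE _).1 hw).2
    have e1 : (s • z + t • ((0:X), z.2)).2 = z.2 := by
      simp [← add_smul, hst]
    have e2 : (s • z + t • ((0:X), z.2)).1 = s • z.1 := by simp
    rw [e1, e2, norm_smul, Real.norm_of_nonneg hs] at h2
    have hp : 0 < ‖z.2‖ := norm_pos_iff.2 hne
    have hs1 : s = 1 := by nlinarith
    have ht0 : t = 0 := by linarith
    subst hs1 ht0
    simp at h0
    exact hφz h0
  have H1 : ∀ a c : X, (a, (0:Y)) ∈ B → (c, (0:Y)) ∈ B → (0:X) ∉ segment ℝ a c →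
      (0 < φ (a, 0) ↔ 0 < φ (c, 0)) := by
    intro a c ha hc h
    refine seg _ ha _ hc ?_
    rintro w ⟨s, t, hs, ht, hst, rfl⟩ h0
    have h2 := ((mE _).1 (φE _ (conv ha hc hs ht hst) h0)).2
    simp at h2
    exact h ⟨s, t, hs, ht, hst, h2⟩
  have H2 : ∀ a c : Y, ((0:X), a) ∈ B → ((0:X), c) ∈ B → (0:Y) ∉ segment ℝ a c →
      (0 < φ (0, a) ↔ 0 < φ (0, c)) := by
    intro a c ha hc h
    refine seg _ ha _ hc ?_
    rintro w ⟨s, t, hs, ht, hst, rfl⟩ h0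
    have h2 := ((mE _).1 (φE _ (conv ha hc hs ht hst) h0)).2
    simp at h2
    exact h ⟨s, t, hs, ht, hst, (norm_eq_zero.1 (by simpa using h2.symm))⟩
  -- main step
  have main : ∀ u ∈ E, φ u ≠ 0 → ∀ v ∈ B, ∀ w ∈ B, 2 ≤ ‖F v - F w‖ → φ v ≠ 0 → φ w ≠ 0 →
      (0 < φ u ↔ 0 < φ v) ∨ (0 < φ u ↔ 0 < φ w) := by
    intro u hu hφu v hv w hw h2 hφv hφw
    obtain ⟨huB, hun⟩ := (mE u).1 hu
    have hu1 : u.1 ≠ 0 := by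
      intro h
      have : u = 0 := Prod.ext h (norm_eq_zero.1 (by rw [← hun, h, norm_zero]))
      apply hφu; simp [hφ, this, F0]
    have hu2 : u.2 ≠ 0 := by
      intro h; exact hu1 (norm_eq_zero.1 (by rw [hun, h, norm_zero]))
    obtain ⟨b1, i1⟩ := V1 u huB hφu hu1 hun.ge
    obtain ⟨b2, i2⟩ := V2 u huB hφu hu2 hun.le
    have hv' := (mB2 v).1 hv
    have hw' := (mB2 w).1 hw
    rcases pr v hv w hw h2 with ⟨hwv, hn⟩ | ⟨hwv, hn⟩
    · have hn' : ‖w.1‖ = 1 := by rw [hwv, norm_neg, hn]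
      have hv1 : v.1 ≠ 0 := by intro h; simp [h] at hn
      have hw1 : w.1 ≠ 0 := by intro h; simp [h] at hn'
      obtain ⟨c1, j1⟩ := V1 v hv hφv hv1 (by rw [hn]; exact hv'.2)
      obtain ⟨c2, j2⟩ := V1 w hw hφw hw1 (by rw [hn']; exact hw'.2)
      rcases aux_not_seg hu1 hv1 with h | h
      · left; rw [i1, j1]; exact H1 _ _ b1 c1 h
      · right; rw [i1, j2]; exact H1 _ _ b1 c2 (by rw [hwv]; exact h)
    · have hn' : ‖w.2‖ = 1 := by rw [hwv, norm_neg, hn]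
      have hv1 : v.2 ≠ 0 := by intro h; simp [h] at hn
      have hw1 : w.2 ≠ 0 := by intro h; simp [h] at hn'
      obtain ⟨c1, j1⟩ := V2 v hv hφv hv1 (by rw [hn]; exact hv'.1)
      obtain ⟨c2, j2⟩ := V2 w hw hφw hw1 (by rw [hn']; exact hw'.1)
      rcases aux_not_seg hu2 hv1 with h | h
      · left; rw [i2, j1]; exact H2 _ _ b2 c1 h
      · right; rw [i2, j2]; exact H2 _ _ b2 c2 (by rw [hwv]; exact h)
  apply Set.Subset.antisymm
  · rintro _ ⟨u, hu, rfl⟩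
    have huB := ((mE u).1 hu).1
    rw [mE]
    refine ⟨hbij.mapsTo huB, ?_⟩
    by_contra hne'
    have hφu : φ u ≠ 0 := sub_ne_zero.2 hne'
    rcases lt_or_gt_of_ne hφu with hlt | hgt
    · obtain ⟨v, hv, ev⟩ := hbij.surjOn (show (x₀, (0:Y)) ∈ B by rw [mB2]; simp [hx₀])
      obtain ⟨w, hw, ew⟩ := hbij.surjOn (show (-x₀, (0:Y)) ∈ B by rw [mB2]; simp [hx₀])
      have f1 : φ v = 1 := by simp [hφ, ev, hx₀]
      have f2 : φ w = 1 := by simp [hφ, ew, hx₀]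
      have := main u hu hφu v hv w hw (by
        rw [ev, ew, Prod.norm_def]; exact (two1 _ hx₀).1.ge.trans (le_max_left _ _))
        (by rw [f1]; norm_num) (by rw [f2]; norm_num)
      rw [f1, f2] at this
      rcases this with h | h <;> linarith [h.2 one_pos]
    · obtain ⟨v, hv, ev⟩ := hbij.surjOn (show ((0:X), y₀) ∈ B by rw [mB2]; simp [hy₀])
      obtain ⟨w, hw, ew⟩ := hbij.surjOn (show ((0:X), -y₀) ∈ B by rw [mB2]; simp [hy₀])
      have f1 : φ v = -1 := by simp [hφ, ev, hy₀]
      have f2 : φ w = -1 := by simp [hφ, ew, hy₀]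
      have := main u hu hφu v hv w hw (by
        rw [ev, ew, Prod.norm_def]; exact (two2 _ hy₀).1.ge.trans (le_max_right _ _))
        (by rw [f1]; norm_num) (by rw [f2]; norm_num)
      rw [f1, f2] at this
      rcases this with h | h <;> linarith [h.1 hgt]
  · intro e he
    obtain ⟨u, hu, rfl⟩ := hbij.surjOn ((mE e).1 he).1
    exact ⟨u, preE u hu he, rfl⟩
end

section
/- Let X and Y be nontrivial strictly convex real Banach spaces, let Z = X ⊕_∞ Y, and let F : B_Z → B_Z be a non-expansive bijection of the closed unit ball onto itself. Then F maps the set of extreme points of B_Z bijectively onto itself: F(ext B_Z) = ext B_Z. -/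
namespace LinfSum

lemma ext_mid {Z : Type*} [NormedAddCommGroup Z] [NormedSpace ℝ Z] {e z : Z}
    (he : e ∈ Set.extremePoints ℝ (Metric.closedBall (0 : Z) 1))
    (h1 : ‖e + z‖ ≤ 1) (h2 : ‖e - z‖ ≤ 1) : z = 0 := by
  have := (mem_extremePoints_iff_left.1 he).2 (e + z) (by simpa using h1) (e - z)
    (by simpa using h2) ⟨1/2, 1/2, by norm_num, by norm_num, by norm_num, by module⟩
  simpa using this

lemma ext_hom {Z : Type*} [NormedAddCommGroup Z] [NormedSpace ℝ Z] {e z : Z} {t : ℝ}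
    (he : e ∈ Set.extremePoints ℝ (Metric.closedBall (0 : Z) 1))
    (ht0 : 0 < t) (ht1 : t < 1)
    (h1 : ‖z‖ ≤ t) (h2 : ‖e - z‖ ≤ 1 - t) : z = t • e := by
  have h1t : 0 < 1 - t := by linarith
  have := (mem_extremePoints_iff_left.1 he).2 (t⁻¹ • z)
    (by
      rw [mem_closedBall_zero_iff, norm_smul, norm_inv, Real.norm_of_nonneg ht0.le,
        inv_mul_le_iff₀ ht0]; linarith) ((1 - t)⁻¹ • (e - z))
    (by
      rw [mem_closedBall_zero_iff, norm_smul, norm_inv, Real.norm_of_nonneg h1t.le,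
        inv_mul_le_iff₀ h1t]; linarith)
    ⟨t, 1 - t, ht0, h1t, by ring, by
      rw [smul_smul, smul_smul, mul_inv_cancel₀ ht0.ne', mul_inv_cancel₀ h1t.ne']; simp⟩
  rw [← this, smul_smul, mul_inv_cancel₀ ht0.ne', one_smul]

section gen
variable {Z : Type*} [NormedAddCommGroup Z] [NormedSpace ℝ Z] {F : Z → Z}

lemma map_zero' (hbij : Set.BijOn F (Metric.closedBall 0 1) (Metric.closedBall 0 1))
    (hL : ∀ p q, ‖p‖ ≤ 1 → ‖q‖ ≤ 1 → ‖F p - F q‖ ≤ ‖p - q‖) : F 0 = 0 := by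
  by_contra h
  have hp : 0 < ‖F 0‖ := norm_pos_iff.2 h
  obtain ⟨r, hr, hrq⟩ := hbij.surjOn (show -(‖F 0‖⁻¹ • F 0) ∈ Metric.closedBall (0 : Z) 1 by
    rw [mem_closedBall_zero_iff, norm_neg, norm_smul, norm_inv, norm_norm,
      inv_mul_cancel₀ hp.ne'])
  rw [mem_closedBall_zero_iff] at hr
  have h1 := hL r 0 hr (by simp)
  rw [hrq, sub_zero] at h1
  have h2 : -(‖F 0‖⁻¹ • F 0) - F 0 = -((‖F 0‖⁻¹ + 1) • F 0) := by module
  rw [h2, norm_neg, norm_smul, Real.norm_of_nonneg (by positivity), add_mul,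
    inv_mul_cancel₀ hp.ne'] at h1
  linarith

lemma pre_ext (hbij : Set.BijOn F (Metric.closedBall 0 1) (Metric.closedBall 0 1))
    (hL : ∀ p q, ‖p‖ ≤ 1 → ‖q‖ ≤ 1 → ‖F p - F q‖ ≤ ‖p - q‖) {x : Z} (hx : ‖x‖ ≤ 1)
    (he : F x ∈ Set.extremePoints ℝ (Metric.closedBall (0 : Z) 1)) (w : Z)
    (h1 : ‖x + w‖ ≤ 1) (h2 : ‖x - w‖ ≤ 1) : w = 0 := by
  have F0 := map_zero' hbij hL
  have key : ∀ y, ‖y‖ ≤ 1 → F y = - F x → ∀ m, ‖m‖ ≤ 1 → ‖m - x‖ ≤ 1 → ‖m - y‖ ≤ 1 → m = 0 := by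
    intro y hy hyx m hm hmx hmy
    have a1 := (hL m x hm hx).trans hmx
    have a2 := (hL m y hm hy).trans hmy
    have : F m = 0 := ext_mid he (by rw [hyx, sub_neg_eq_add, add_comm] at a2; exact a2)
      (by rw [norm_sub_rev]; exact a1)
    exact hbij.injOn (by simpa using hm) (by simp) (this.trans F0.symm)
  have hFx : ‖F x‖ ≤ 1 := by simpa using he.1
  obtain ⟨y, hy, hyx⟩ := hbij.surjOn (show - F x ∈ Metric.closedBall (0 : Z) 1 by simpa using hFx)
  rw [mem_closedBall_zero_iff] at hy
  have half : ∀ v : Z, ‖v‖ ≤ 2 → ‖(1/2 : ℝ) • v‖ ≤ 1 := by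
    intro v hv
    rw [norm_smul]; norm_num; linarith
  have hxy : ‖y - x‖ ≤ 2 := (norm_sub_le _ _).trans (by linarith)
  have hm := key y hy hyx ((1/2 : ℝ) • (x + y)) (half _ ((norm_add_le _ _).trans (by linarith)))
    (by
      have : (1/2 : ℝ) • (x + y) - x = (1/2 : ℝ) • (y - x) := by module
      rw [this]; exact half _ hxy)
    (by
      have : (1/2 : ℝ) • (x + y) - y = (1/2 : ℝ) • (x - y) := by module
      rw [this]; exact half _ (by rw [norm_sub_rev]; exact hxy))
  have hyn : y = -x := by
    have : x + y = 0 := (smul_eq_zero.1 hm).resolve_left (by norm_num)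
    exact (neg_eq_of_add_eq_zero_right this).symm
  subst hyn
  refine key _ hy hyx w ?_ (by rw [norm_sub_rev]; exact h2) (by rw [sub_neg_eq_add, add_comm]; exact h1)
  have : w = (1/2 : ℝ) • ((x + w) - (x - w)) := by module
  rw [this]
  exact half _ ((norm_sub_le _ _).trans (by linarith))

lemma hom (hbij : Set.BijOn F (Metric.closedBall 0 1) (Metric.closedBall 0 1))
    (hL : ∀ p q, ‖p‖ ≤ 1 → ‖q‖ ≤ 1 → ‖F p - F q‖ ≤ ‖p - q‖) {x : Z} (hx : ‖x‖ ≤ 1)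
    (he : F x ∈ Set.extremePoints ℝ (Metric.closedBall (0 : Z) 1)) {t : ℝ} (h0 : 0 < t)
    (h1 : t ≤ 1) : F (t • x) = t • F x := by
  have F0 := map_zero' hbij hL
  rcases h1.eq_or_lt with rfl | h1
  · simp
  have ht : ‖t • x‖ ≤ t := by
    rw [norm_smul, Real.norm_of_nonneg h0.le]; nlinarith
  refine ext_hom he h0 h1 ?_ ?_
  · have := hL (t • x) 0 (by linarith) (by simp)
    rw [F0, sub_zero, sub_zero] at this
    linarith
  · refine (hL x (t • x) hx (by linarith)).trans ?_
    have : x - t • x = (1 - t) • x := by module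
    rw [this, norm_smul, Real.norm_of_nonneg (by linarith)]
    nlinarith
end gen

/-- The part of the ball off the diagonal. -/
def R (X Y : Type*) [NormedAddCommGroup X] [NormedAddCommGroup Y] : Set (X × Y) :=
  {z | ‖z‖ ≤ 1 ∧ ‖z.1‖ ≠ ‖z.2‖}

section prodd
variable {X Y : Type*} [NormedAddCommGroup X] [NormedSpace ℝ X]
    [NormedAddCommGroup Y] [NormedSpace ℝ Y]

lemma norms_of_mid [Nontrivial X] {x : X × Y} (hx : ‖x‖ ≤ 1)
    (h : ∀ w, ‖x + w‖ ≤ 1 → ‖x - w‖ ≤ 1 → w = 0) : ‖x.1‖ = 1 := by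
  rw [Prod.norm_def, max_le_iff] at hx
  by_contra hne
  have hlt : ‖x.1‖ < 1 := lt_of_le_of_ne hx.1 hne
  obtain ⟨w, hw⟩ := exists_norm_eq X (show 0 ≤ 1 - ‖x.1‖ by linarith)
  have := h (w, 0) (by
      rw [Prod.norm_def, max_le_iff]
      exact ⟨(norm_add_le _ _).trans (by simp [hw]), by simpa using hx.2⟩) (by
      rw [Prod.norm_def, max_le_iff]
      exact ⟨(norm_sub_le _ _).trans (by simp [hw]), by simpa using hx.2⟩)
  rw [Prod.mk_eq_zero] at this
  rw [this.1, norm_zero] at hw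
  linarith

lemma norms_of_mid' [Nontrivial Y] {x : X × Y} (hx : ‖x‖ ≤ 1)
    (h : ∀ w, ‖x + w‖ ≤ 1 → ‖x - w‖ ≤ 1 → w = 0) : ‖x.2‖ = 1 := by
  have sw : ∀ z : X × Y, ‖z.swap‖ = ‖z‖ := fun z => by simp [Prod.norm_def, max_comm]
  refine norms_of_mid (x := x.swap) (by rwa [sw]) fun w h1 h2 => ?_
  have := h w.swap (by rw [← sw]; simpa using h1) (by rw [← sw]; simpa using h2)
  simpa [Prod.ext_iff, and_comm] using this

lemma ext_iff [StrictConvexSpace ℝ X] [StrictConvexSpace ℝ Y] [Nontrivial X] [Nontrivial Y]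
    (x : X × Y) : x ∈ Set.extremePoints ℝ (Metric.closedBall (0 : X × Y) 1) ↔
      ‖x.1‖ = 1 ∧ ‖x.2‖ = 1 := by
  constructor
  · intro h
    have hx : ‖x‖ ≤ 1 := by simpa using h.1
    exact ⟨norms_of_mid hx fun w => ext_mid h, norms_of_mid' hx fun w => ext_mid h⟩
  · rintro ⟨h1, h2⟩
    have : Metric.closedBall (0 : X × Y) 1 = Metric.closedBall 0 1 ×ˢ Metric.closedBall 0 1 := by
      rw [closedBall_prod_same]; rfl
    rw [this, extremePoints_prod]
    exact ⟨StrictConvexSpace.sphere_subset_extremePoints_closedBall 0 one_ne_zero (by simpa using h1),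
      StrictConvexSpace.sphere_subset_extremePoints_closedBall 0 one_ne_zero (by simpa using h2)⟩

lemma joinA {u : X} {v : Y} (hu : ‖u‖ ≤ 1) (hv : ‖v‖ < ‖u‖) : JoinedIn (R X Y) (u, v) (u, 0) := by
  refine JoinedIn.of_segment_subset ?_
  rintro _ ⟨s, t, hs, ht, hst, rfl⟩
  have e1 : s • u + t • u = u := by rw [← add_smul, hst, one_smul]
  have e2 : ‖s • v‖ ≤ ‖v‖ := by
    rw [norm_smul, Real.norm_of_nonneg hs]; nlinarith [norm_nonneg v]
  simp only [R, Set.mem_ofPred_eq, Prod.norm_def, Prod.fst_add, Prod.snd_add, Prod.smul_fst,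
    Prod.smul_snd, smul_zero, add_zero, e1, max_le_iff]
  exact ⟨⟨hu, by linarith⟩, (e2.trans_lt hv).ne'⟩

lemma joinB {u a : X} (hu : ‖u‖ ≤ 1) (ha : ‖a‖ ≤ 1) (h : (0 : X) ∉ segment ℝ u a) :
    JoinedIn (R X Y) (u, 0) (a, 0) := by
  refine JoinedIn.of_segment_subset ?_
  rintro _ ⟨s, t, hs, ht, hst, rfl⟩
  have e : s • u + t • a ∈ segment ℝ u a := ⟨s, t, hs, ht, hst, rfl⟩
  have e0 : s • u + t • a ≠ 0 := fun h' => h (h' ▸ e)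
  have e1 : ‖s • u + t • a‖ ≤ 1 := by
    refine (norm_add_le _ _).trans ?_
    rw [norm_smul, norm_smul, Real.norm_of_nonneg hs, Real.norm_of_nonneg ht]
    nlinarith
  simp only [R, Set.mem_ofPred_eq, Prod.norm_def, Prod.fst_add, Prod.snd_add, Prod.smul_fst,
    Prod.smul_snd, smul_zero, add_zero, max_le_iff, norm_zero]
  exact ⟨⟨e1, by norm_num⟩, norm_ne_zero_iff.2 e0⟩

lemma joinC {u a : X} (hu : ‖u‖ ≤ 1) (ha : ‖a‖ = 1) (hu0 : u ≠ 0) :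
    JoinedIn (R X Y) (u, 0) (a, 0) ∨ JoinedIn (R X Y) (u, 0) (-a, 0) := by
  by_cases h : (0 : X) ∈ segment ℝ u a
  · right
    refine joinB hu (by simp [ha]) ?_
    rintro ⟨s, t, hs, ht, hst, h2⟩
    obtain ⟨s', t', hs', ht', hst', h1⟩ := h
    have ha0 : a ≠ 0 := by rintro rfl; simp at ha
    have : (s * t' + s' * t) • a = 0 := by
      have : (s * t' + s' * t) • a = s • (s' • u + t' • a) - s' • (s • u + t • -a) := by module
      rw [this, h1, h2]; simp
    have h3 : s * t' + s' * t = 0 := (smul_eq_zero.1 this).resolve_right ha0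
    have h4 : s * t' = 0 := by nlinarith [mul_nonneg hs ht', mul_nonneg hs' ht]
    have h5 : s' * t = 0 := by nlinarith
    rcases mul_eq_zero.1 h4 with rfl | rfl
    · have : t = 1 := by linarith
      subst this
      simp [ha0] at h2
    · have : s' = 1 := by linarith
      subst this
      simp [hu0] at h1
  · exact Or.inl (joinB hu ha.le h)

lemma join_swap {p q : X × Y} (h : JoinedIn (R X Y) p q) : JoinedIn (R Y X) p.swap q.swap := by
  refine (h.map continuous_swap).mono ?_
  rintro _ ⟨z, hz, rfl⟩
  refine ⟨?_, hz.2.symm⟩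
  have : ‖z.swap‖ = ‖z‖ := by simp [Prod.norm_def, max_comm]
  rw [this]; exact hz.1

lemma joinD {a : X} (ha : ‖a‖ = 1) {z : X × Y} (hz : ‖z‖ ≤ 1) (h : ‖z.2‖ < ‖z.1‖) :
    JoinedIn (R X Y) z (a, 0) ∨ JoinedIn (R X Y) z (-a, 0) := by
  have h1 : ‖z.1‖ ≤ 1 := (norm_fst_le z).trans hz
  have h0 : z.1 ≠ 0 := norm_pos_iff.1 ((norm_nonneg _).trans_lt h)
  exact (joinC h1 ha h0).imp (joinA h1 h).trans (joinA h1 h).trans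

lemma joinE {a : X} {b : Y} (ha : ‖a‖ = 1) (hb : ‖b‖ = 1) {z : X × Y} (hz : z ∈ R X Y) :
    ∃ i : Fin 4, JoinedIn (R X Y) z (![(a, 0), (-a, 0), (0, b), (0, -b)] i) := by
  rcases lt_or_gt_of_ne hz.2 with h | h
  · have : ‖z.swap‖ = ‖z‖ := by simp [Prod.norm_def, max_comm]
    rcases joinD hb (z := z.swap) (by rw [this]; exact hz.1) h with h | h
    · exact ⟨2, by simpa using join_swap h⟩
    · exact ⟨3, by simpa using join_swap h⟩
  · rcases joinD ha hz.1 h with h | h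
    · exact ⟨0, by simpa using h⟩
    · exact ⟨1, by simpa using h⟩

lemma not_join {a : X} {b : Y} (ha : ‖a‖ = 1) (hb : ‖b‖ = 1) :
    ¬ JoinedIn (R X Y) (a, 0) (0, b) := by
  rintro ⟨γ, hγ⟩
  have hc : Continuous fun t => ‖(γ t).1‖ - ‖(γ t).2‖ := by fun_prop
  have := mem_range_of_exists_le_of_exists_ge hc (c := 0) ⟨1, by simp [hb]⟩ ⟨0, by simp [ha]⟩
  obtain ⟨t, ht⟩ := this
  exact (hγ t).2 (sub_eq_zero.1 ht)

/-- Joinability in `R`. -/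
def rel (X Y : Type*) [NormedAddCommGroup X] [NormedAddCommGroup Y] : Setoid (R X Y) where
  r p q := JoinedIn (R X Y) p q
  iseqv := ⟨fun p => JoinedIn.refl p.2, fun h => h.symm, fun h h' => h.trans h'⟩

theorem topo {a : X} {b : Y} (ha : ‖a‖ = 1) (hb : ‖b‖ = 1) {F : X × Y → X × Y} {D : Set (X × Y)}
    (hRD : R X Y ⊆ D) (hF : ContinuousOn F D) (hm : Set.MapsTo F D (R X Y))
    (hs : Set.SurjOn F D (R X Y)) (hD : ∀ z ∈ D, ∃ r ∈ R X Y, JoinedIn D z r) :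
    ¬ JoinedIn D (a, 0) (0, b) := by
  intro hj
  have push : ∀ {p q}, JoinedIn D p q → JoinedIn (R X Y) (F p) (F q) := fun h =>
    (h.map_continuousOn hF).mono hm.image_subset
  have ma : ∀ c : X, ‖c‖ = 1 → ((c, 0) : X × Y) ∈ R X Y := fun c hc => by
    simp [R, Prod.norm_def, hc]
  have mb : ∀ c : Y, ‖c‖ = 1 → ((0, c) : X × Y) ∈ R X Y := fun c hc => by
    simp [R, Prod.norm_def, hc]
  have mi : ∀ i : Fin 4, (![(a, 0), (-a, 0), (0, b), (0, -b)] i : X × Y) ∈ R X Y := by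
    intro i
    fin_cases i
    · exact ma a ha
    · exact ma (-a) (by simpa using ha)
    · exact mb b hb
    · exact mb (-b) (by simpa using hb)
  have fin : Finite (Quotient (rel X Y)) := by
    refine Finite.of_surjective (fun i : Fin 4 => (Quotient.mk (rel X Y) ⟨_, mi i⟩)) ?_
    intro q
    induction q using Quotient.inductionOn with
    | h z =>
      obtain ⟨i, hi⟩ := joinE ha hb z.2
      exact ⟨i, Quotient.sound hi.symm⟩
  let φ : Quotient (rel X Y) → Quotient (rel X Y) :=
    Quotient.map (fun z : R X Y => (⟨F z, hm (hRD z.2)⟩ : R X Y))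
      (fun p q (h : JoinedIn (R X Y) p q) => push (h.mono hRD))
  have hφ : Function.Surjective φ := by
    intro q
    induction q using Quotient.inductionOn with
    | h z =>
      obtain ⟨d, hd, hdz⟩ := hs z.2
      obtain ⟨r, hr, hdr⟩ := hD d hd
      refine ⟨Quotient.mk _ ⟨r, hr⟩, Quotient.sound ?_⟩
      have := push hdr.symm
      rw [hdz] at this
      exact this
  have hinj := Finite.injective_iff_surjective.2 hφ
  have h1 : φ (Quotient.mk _ ⟨(a, 0), ma a ha⟩) = φ (Quotient.mk _ ⟨(0, b), mb b hb⟩) :=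
    Quotient.sound (push hj)
  exact not_join ha hb (Quotient.exact (hinj h1))

end prodd
end LinfSum

/-- For nontrivial strictly convex real Banach spaces X and Y, a non-expansive
bijection F of the closed unit ball of Z = X ⊕_∞ Y onto itself maps the set of
extreme points of the ball bijectively onto itself: F(ext B_Z) = ext B_Z. -/
theorem image_of_extremePoints_linf_sum_strictly_convex
    (X Y : Type*) [NormedAddCommGroup X] [NormedSpace ℝ X] [CompleteSpace X]
    [NormedAddCommGroup Y] [NormedSpace ℝ Y] [CompleteSpace Y]
    [StrictConvexSpace ℝ X] [StrictConvexSpace ℝ Y]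
    [Nontrivial X] [Nontrivial Y]
    (B : Set (X × Y)) (hB : B = Metric.closedBall (0 : X × Y) 1)
    (F : X × Y → X × Y) (hbij : Set.BijOn F B B) (hne : LipschitzOnWith 1 F B) :
    F '' Set.extremePoints ℝ B = Set.extremePoints ℝ B := by

  subst hB
  have hL : ∀ p q, ‖p‖ ≤ 1 → ‖q‖ ≤ 1 → ‖F p - F q‖ ≤ ‖p - q‖ := by
    intro p q hp hq
    have := hne.dist_le_mul p (by simpa using hp) q (by simpa using hq)
    simpa [dist_eq_norm] using this
  have F0 := LinfSum.map_zero' hbij hL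
  have pre : ∀ x, ‖x‖ ≤ 1 → F x ∈ Set.extremePoints ℝ (Metric.closedBall (0 : X × Y) 1) →
      ‖x.1‖ = 1 ∧ ‖x.2‖ = 1 := fun x hx he =>
    ⟨LinfSum.norms_of_mid hx (LinfSum.pre_ext hbij hL hx he),
      LinfSum.norms_of_mid' hx (LinfSum.pre_ext hbij hL hx he)⟩
  -- points mapped to the diagonal
  have diag : ∀ z, ‖z‖ ≤ 1 → ‖(F z).1‖ = ‖(F z).2‖ → z ≠ 0 →
      ∃ (x : X × Y) (s : ℝ), ‖x.1‖ = 1 ∧ ‖x.2‖ = 1 ∧ 0 < s ∧ s ≤ 1 ∧ z = s • x ∧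
        F x ∈ Set.extremePoints ℝ (Metric.closedBall (0 : X × Y) 1) := by
    intro z hz hzz hz0
    have hzB : z ∈ Metric.closedBall (0 : X × Y) 1 := by simpa using hz
    have hFz : F z ≠ 0 := fun h => hz0 (hbij.injOn hzB (by simp) (h.trans F0.symm))
    have hn1 : ‖(F z).1‖ = ‖F z‖ := by rw [Prod.norm_def, ← hzz, max_self]
    have hn2 : ‖(F z).2‖ = ‖F z‖ := by rw [← hzz, hn1]
    have hpos : 0 < ‖F z‖ := norm_pos_iff.2 hFz
    have hle : ‖F z‖ ≤ 1 := by simpa using hbij.mapsTo hzB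
    have he : ‖F z‖⁻¹ • F z ∈ Set.extremePoints ℝ (Metric.closedBall (0 : X × Y) 1) := by
      rw [LinfSum.ext_iff]
      simp only [Prod.smul_fst, Prod.smul_snd, norm_smul, hn1, hn2, norm_inv, norm_norm]
      exact ⟨inv_mul_cancel₀ hpos.ne', inv_mul_cancel₀ hpos.ne'⟩
    obtain ⟨x, hx, hxe⟩ := hbij.surjOn he.1
    rw [← hxe] at he
    have hx1 : ‖x‖ ≤ 1 := by simpa using hx
    obtain ⟨n1, n2⟩ := pre x hx1 he
    refine ⟨x, ‖F z‖, n1, n2, hpos, hle, ?_, he⟩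
    refine hbij.injOn hzB ?_ ?_
    · rw [mem_closedBall_zero_iff, norm_smul, norm_norm]
      exact mul_le_one₀ hle (norm_nonneg _) hx1
    · rw [LinfSum.hom hbij hL hx1 he hpos hle, hxe, smul_smul, mul_inv_cancel₀ hpos.ne', one_smul]
  apply Set.Subset.antisymm
  · rintro _ ⟨p, hp, rfl⟩
    by_contra hcon
    obtain ⟨a, b⟩ := p
    have hpB : ‖((a, b) : X × Y)‖ ≤ 1 := by simpa using hp.1
    obtain ⟨ha, hb⟩ := (LinfSum.ext_iff _).1 hp
    simp only at ha hb
    set D : Set (X × Y) := {z | ‖z‖ ≤ 1 ∧ F z ∈ LinfSum.R X Y} with hDdef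
    have hRD : LinfSum.R X Y ⊆ D := by
      intro z hz
      refine ⟨hz.1, by simpa using hbij.mapsTo (by simpa using hz.1), fun h => ?_⟩
      have hz0 : z ≠ 0 := by rintro rfl; exact hz.2 (by simp)
      obtain ⟨x, s, h1, h2, -, -, rfl, -⟩ := diag z hz.1 h hz0
      exact hz.2 (by simp [norm_smul, h1, h2])
    have hDs : ∀ z ∈ D, ‖z.1‖ = ‖z.2‖ → JoinedIn D z (z.1, 0) ∧ JoinedIn D z (0, z.2) ∧ z ≠ 0 := by
      intro z hz heq
      have hz0 : z ≠ 0 := by rintro rfl; exact hz.2.2 (by simp [F0])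
      have hn1 : ‖z.1‖ = ‖z‖ := by rw [Prod.norm_def, ← heq, max_self]
      have hn2 : ‖z.2‖ = ‖z‖ := by rw [← heq, hn1]
      have hpos : 0 < ‖z‖ := norm_pos_iff.2 hz0
      refine ⟨JoinedIn.of_segment_subset ?_, JoinedIn.of_segment_subset ?_, hz0⟩
      · rintro _ ⟨s, t, hs, ht, hst, rfl⟩
        rcases ht.eq_or_lt with rfl | ht
        · have : s = 1 := by linarith
          subst this
          simpa using hz
        · apply hRD
          have e1 : s • z.1 + t • z.1 = z.1 := by rw [← add_smul, hst, one_smul]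
          simp only [LinfSum.R, Set.mem_ofPred_eq, Prod.norm_def, Prod.fst_add, Prod.snd_add,
            Prod.smul_fst, Prod.smul_snd, smul_zero, add_zero, e1, max_le_iff]
          rw [norm_smul, Real.norm_of_nonneg hs, hn1, hn2]
          have := hz.1
          refine ⟨⟨this, by nlinarith⟩, ?_⟩
          have : s * ‖z‖ < ‖z‖ := by nlinarith
          exact this.ne'
      · rintro _ ⟨s, t, hs, ht, hst, rfl⟩
        rcases ht.eq_or_lt with rfl | ht
        · have : s = 1 := by linarith
          subst this
          simpa using hz
        · apply hRD
          have e1 : s • z.2 + t • z.2 = z.2 := by rw [← add_smul, hst, one_smul]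
          simp only [LinfSum.R, Set.mem_ofPred_eq, Prod.norm_def, Prod.fst_add, Prod.snd_add,
            Prod.smul_fst, Prod.smul_snd, smul_zero, add_zero, e1, max_le_iff]
          rw [norm_smul, Real.norm_of_nonneg hs, hn1, hn2]
          have := hz.1
          refine ⟨⟨by nlinarith, this⟩, ?_⟩
          have : s * ‖z‖ < ‖z‖ := by nlinarith
          exact this.ne
    have hpD : ((a, b) : X × Y) ∈ D := by
      refine ⟨hpB, by simpa using hbij.mapsTo hp.1, fun h => ?_⟩
      have hp0 : ((a, b) : X × Y) ≠ 0 := by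
        intro h0
        rw [Prod.mk_eq_zero] at h0
        rw [h0.1, norm_zero] at ha
        norm_num at ha
      obtain ⟨x, s, h1, h2, hs, -, hxs, he⟩ := diag _ hpB h hp0
      have hs1 : s = 1 := by
        have : a = s • x.1 := congrArg Prod.fst hxs
        rw [this, norm_smul, h1, Real.norm_of_nonneg hs.le, mul_one] at ha
        exact ha
      rw [hs1, one_smul] at hxs
      rw [hxs] at hcon
      exact hcon he
    refine LinfSum.topo ha hb hRD (hne.continuousOn.mono fun z hz => by simpa using hz.1)
      (fun z hz => hz.2) ?_ ?_ ((hDs _ hpD (by simp [ha, hb])).1.symm.trans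
        (hDs _ hpD (by simp [ha, hb])).2.1)
    · intro q hq
      obtain ⟨z, hz, rfl⟩ := hbij.surjOn (show q ∈ Metric.closedBall (0 : X × Y) 1 by
        simpa using hq.1)
      exact ⟨z, ⟨by simpa using hz, hq⟩, rfl⟩
    · intro z hz
      by_cases heq : ‖z.1‖ = ‖z.2‖
      · obtain ⟨h1, -, h0⟩ := hDs z hz heq
        refine ⟨_, ⟨?_, ?_⟩, h1⟩
        · exact h1.target_mem.1
        · intro h
          simp only [norm_zero, norm_eq_zero] at h
          have h2 : z.2 = 0 := by rw [h, norm_zero] at heq; exact norm_eq_zero.1 heq.symm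
          exact h0 (Prod.ext h h2)
      · exact ⟨z, ⟨hz.1, heq⟩, JoinedIn.refl hz⟩
  · intro e he
    obtain ⟨x, hx, rfl⟩ := hbij.surjOn he.1
    exact ⟨x, (LinfSum.ext_iff x).2 (pre x (by simpa using hx) he), rfl⟩
end

section
/- Let X and Y be strictly convex real Banach spaces each of dimension at least 2, let Z = X ⊕_∞ Y, let Z_X = { z ∈ B_Z : ‖z_x‖ > ‖z_y‖ } and Z_Y = { z ∈ B_Z : ‖z_x‖ < ‖z_y‖ } (where z_x and z_y are the X- and Y-components of z), and let F : B_Z → B_Z be a non-expansive bijection of the closed unit ball onto itself. Then either F(Z_X) = Z_X and F(Z_Y) = Z_Y, or F(Z_X) = Z_Y and F(Z_Y) = Z_X. -/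
lemma aux_neg_s19 {E : Type*} [NormedAddCommGroup E] [NormedSpace ℝ E] [StrictConvexSpace ℝ E]
    {a b : E} (ha : ‖a‖ ≤ 1) (hb : ‖b‖ ≤ 1) (h : 2 ≤ ‖a - b‖) : ‖b‖ = 1 ∧ b = -a := by
  have h1 : ‖a - b‖ ≤ ‖a‖ + ‖b‖ := norm_sub_le a b
  have h2 : ‖a‖ = 1 := by linarith
  have h3 : ‖b‖ = 1 := by linarith
  refine ⟨h3, ?_⟩
  have := eq_of_norm_eq_of_norm_add_eq (x := a) (y := -b) (by rw [norm_neg, h2, h3])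
    (by rw [← sub_eq_add_neg, norm_neg]; linarith)
  rw [this, neg_neg]

lemma aux_le_or {E G : Type*} [NormedAddCommGroup E] [NormedAddCommGroup G] {p q : E × G} {r : ℝ}
    (h : r ≤ ‖p - q‖) : r ≤ ‖p.1 - q.1‖ ∨ r ≤ ‖p.2 - q.2‖ := by
  rw [Prod.norm_def] at h
  exact le_max_iff.1 h

lemma aux_four_s19 {E G : Type*} [NormedAddCommGroup E] [NormedSpace ℝ E] [StrictConvexSpace ℝ E]
    [NormedAddCommGroup G] [NormedSpace ℝ G] [StrictConvexSpace ℝ G] {x p q z : E × G}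
    (hx1 : ‖x.1‖ ≤ 1) (hp1 : ‖p.1‖ ≤ 1) (hq1 : ‖q.1‖ ≤ 1) (hz1 : ‖z.1‖ ≤ 1)
    (hx2 : ‖x.2‖ ≤ 1) (hp2 : ‖p.2‖ ≤ 1) (hq2 : ‖q.2‖ ≤ 1) (hz2 : ‖z.2‖ ≤ 1)
    (hxp : 2 ≤ ‖x.1 - p.1‖ ∨ 2 ≤ ‖x.2 - p.2‖) (hxq : 2 ≤ ‖x.1 - q.1‖ ∨ 2 ≤ ‖x.2 - q.2‖)
    (hxz : 2 ≤ ‖x.1 - z.1‖ ∨ 2 ≤ ‖x.2 - z.2‖) (hpq : 2 ≤ ‖p.1 - q.1‖ ∨ 2 ≤ ‖p.2 - q.2‖)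
    (hpz : 2 ≤ ‖p.1 - z.1‖ ∨ 2 ≤ ‖p.2 - z.2‖) (hqz : 2 ≤ ‖q.1 - z.1‖ ∨ 2 ≤ ‖q.2 - z.2‖) :
    1 ≤ ‖x.2‖ := by
  by_contra! hlt
  have key : ∀ w : E × G, ‖w.1‖ ≤ 1 → ‖w.2‖ ≤ 1 →
      (2 ≤ ‖x.1 - w.1‖ ∨ 2 ≤ ‖x.2 - w.2‖) → w.1 = -x.1 := by
    intro w h1 h2 h
    rcases h with h | h
    · exact (aux_neg_s19 hx1 h1 h).2
    · have := norm_sub_le x.2 w.2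
      linarith
  have ep := key p hp1 hp2 hxp
  have eq := key q hq1 hq2 hxq
  have ez := key z hz1 hz2 hxz
  have h1 : 2 ≤ ‖p.2 - q.2‖ := by
    rcases hpq with h | h
    · rw [ep, eq, sub_self, norm_zero] at h; linarith
    · exact h
  have h2 : 2 ≤ ‖p.2 - z.2‖ := by
    rcases hpz with h | h
    · rw [ep, ez, sub_self, norm_zero] at h; linarith
    · exact h
  have h3 : 2 ≤ ‖q.2 - z.2‖ := by
    rcases hqz with h | h
    · rw [eq, ez, sub_self, norm_zero] at h; linarith
    · exact h
  have e1 := (aux_neg_s19 hp2 hq2 h1).2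
  have e2 := (aux_neg_s19 hp2 hz2 h2).2
  rw [e1, e2, sub_self, norm_zero] at h3
  linarith

lemma aux_scale {E : Type*} [NormedAddCommGroup E] [NormedSpace ℝ E] [StrictConvexSpace ℝ E]
    {e w : E} {r : ℝ} (he : ‖e‖ = 1) (hw : ‖w‖ ≤ r) (hew : ‖w - e‖ ≤ 1 - r) : w = r • e := by
  have h1 : ‖e‖ ≤ ‖w‖ + ‖w - e‖ := by
    have := norm_sub_le w (w - e)
    rwa [sub_sub_cancel] at this
  have := eq_lineMap_of_dist_eq_mul_of_dist_eq_mul (x := (0 : E)) (y := w) (z := e) (r := r)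
    (by rw [dist_zero_left, dist_zero_left, he]; linarith)
    (by rw [dist_eq_norm, dist_zero_left, he]; linarith)
  rw [this, AffineMap.lineMap_apply_module]; simp

lemma aux_conn {E G : Type*} [NormedAddCommGroup E] [NormedSpace ℝ E]
    [NormedAddCommGroup G] [NormedSpace ℝ G] (h : 2 ≤ Module.rank ℝ E) :
    IsPreconnected {z : E × G | ‖z.1‖ ≤ 1 ∧ ‖z.2‖ < ‖z.1‖} := by
  have h1 : 1 < Module.rank ℝ E := lt_of_lt_of_le (by norm_num) h
  have c1 := isPreconnected_sphere h1 (0 : E) 1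
  have c2 : IsPreconnected (Set.Ioc (0 : ℝ) 1) := isPreconnected_Ioc
  have c3 : IsPreconnected (Metric.ball (0 : G) 1) := (convex_ball _ _).isPreconnected
  have c := (c1.prod (c2.prod c3)).image
    (fun t : E × ℝ × G => ((t.2.1 • t.1, t.2.1 • t.2.2) : E × G)) (by fun_prop)
  convert c using 1
  ext ⟨a, b⟩
  simp only [Set.mem_setOf_eq, Set.mem_image, Set.mem_prod, mem_sphere_zero_iff_norm,
    mem_ball_zero_iff, Set.mem_Ioc, Prod.exists, Prod.mk.injEq]
  constructor
  · rintro ⟨ha, hb⟩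
    have hpos : 0 < ‖a‖ := lt_of_le_of_lt (norm_nonneg b) hb
    refine ⟨‖a‖⁻¹ • a, ‖a‖, ‖a‖⁻¹ • b, ⟨?_, ⟨hpos, ha⟩, ?_⟩, ?_, ?_⟩
    · rw [norm_smul, norm_inv, norm_norm, inv_mul_cancel₀ hpos.ne']
    · rw [norm_smul, norm_inv, norm_norm, inv_mul_lt_iff₀ hpos]; linarith
    · rw [smul_smul, mul_inv_cancel₀ hpos.ne', one_smul]
    · rw [smul_smul, mul_inv_cancel₀ hpos.ne', one_smul]
  · rintro ⟨u, r, v, ⟨hu, ⟨hr, hr1⟩, hv⟩, rfl, rfl⟩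
    rw [norm_smul, norm_smul, hu, Real.norm_of_nonneg hr.le]
    constructor
    · linarith
    · exact mul_lt_mul_of_pos_left hv hr

/-- For strictly convex real Banach spaces X and Y of dimension at least 2, a
non-expansive bijection F of the closed unit ball of Z = X ⊕_∞ Y onto itself
either maps Z_X = {z ∈ B_Z : ‖z_x‖ > ‖z_y‖} onto itself and
Z_Y = {z ∈ B_Z : ‖z_x‖ < ‖z_y‖} onto itself, or swaps the two sets. -/
theorem image_of_open_parts_linf_sum_strictly_convex
    (X Y : Type*) [NormedAddCommGroup X] [NormedSpace ℝ X] [CompleteSpace X]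
    [NormedAddCommGroup Y] [NormedSpace ℝ Y] [CompleteSpace Y]
    [StrictConvexSpace ℝ X] [StrictConvexSpace ℝ Y]
    (hdimX : 2 ≤ Module.rank ℝ X) (hdimY : 2 ≤ Module.rank ℝ Y)
    (B : Set (X × Y)) (hB : B = Metric.closedBall (0 : X × Y) 1)
    (ZX : Set (X × Y)) (hZX : ZX = {z ∈ B | ‖z.2‖ < ‖z.1‖})
    (ZY : Set (X × Y)) (hZY : ZY = {z ∈ B | ‖z.1‖ < ‖z.2‖})
    (F : X × Y → X × Y) (hbij : Set.BijOn F B B) (hne : LipschitzOnWith 1 F B) :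
    (F '' ZX = ZX ∧ F '' ZY = ZY) ∨ (F '' ZX = ZY ∧ F '' ZY = ZX) := by
  have memB : ∀ z : X × Y, z ∈ B ↔ ‖z.1‖ ≤ 1 ∧ ‖z.2‖ ≤ 1 := by
    intro z
    rw [hB, mem_closedBall_zero_iff, Prod.norm_def, max_le_iff]
  have memB' : ∀ z : X × Y, z ∈ B ↔ ‖z‖ ≤ 1 := by
    intro z
    rw [hB, mem_closedBall_zero_iff]
  have hL : ∀ a ∈ B, ∀ b ∈ B, ‖F a - F b‖ ≤ ‖a - b‖ := by
    intro a ha b hb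
    have := hne.dist_le_mul a ha b hb
    simpa [dist_eq_norm] using this
  have h0B : (0 : X × Y) ∈ B := by rw [memB']; simp
  have hF0 : F 0 = 0 := by
    by_contra hp
    have hpos : 0 < ‖F 0‖ := norm_pos_iff.2 hp
    have hq : -(‖F 0‖⁻¹ • F 0) ∈ B := by
      rw [memB', norm_neg, norm_smul, norm_inv, norm_norm, inv_mul_cancel₀ hpos.ne']
    obtain ⟨z, hz, hzq⟩ := hbij.surjOn hq
    have h1 := hL z hz 0 h0B
    rw [hzq, sub_zero] at h1
    have h2 : -(‖F 0‖⁻¹ • F 0) - F 0 = -((‖F 0‖⁻¹ + 1) • F 0) := by module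
    rw [h2, norm_neg, norm_smul, Real.norm_of_nonneg (by positivity), add_mul,
      inv_mul_cancel₀ hpos.ne'] at h1
    have := (memB' z).1 hz
    linarith
  have hFle : ∀ a ∈ B, ‖F a‖ ≤ ‖a‖ := by
    intro a ha
    have := hL a ha 0 h0B
    simpa [hF0] using this
  -- preimages of extreme points are extreme
  have hext : ∀ x ∈ B, ‖(F x).1‖ = 1 → ‖(F x).2‖ = 1 → ‖x.1‖ = 1 ∧ ‖x.2‖ = 1 := by
    intro x hx he hf
    obtain ⟨p, hp, hpF⟩ := hbij.surjOn ((memB ((F x).1, -(F x).2)).2 ⟨he.le, by simp [hf]⟩)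
    obtain ⟨q, hq, hqF⟩ := hbij.surjOn ((memB (-(F x).1, (F x).2)).2 ⟨by simp [he], hf.le⟩)
    obtain ⟨z, hz, hzF⟩ := hbij.surjOn ((memB (-(F x).1, -(F x).2)).2
      ⟨by simp [he], by simp [hf]⟩)
    have n1 : ‖(F x).1 - -(F x).1‖ = 2 := by
      rw [sub_neg_eq_add, ← two_smul ℝ (F x).1, norm_smul, he]; norm_num
    have n2 : ‖(F x).2 - -(F x).2‖ = 2 := by
      rw [sub_neg_eq_add, ← two_smul ℝ (F x).2, norm_smul, hf]; norm_num
    have n1' : ‖-(F x).1 - (F x).1‖ = 2 := by rw [norm_sub_rev]; exact n1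
    have n2' : ‖-(F x).2 - (F x).2‖ = 2 := by rw [norm_sub_rev]; exact n2
    have D1 : ∀ a b : X × Y, a ∈ B → b ∈ B → ‖(F a).1 - (F b).1‖ = 2 → 2 ≤ ‖a - b‖ := by
      intro a b ha hb h
      calc (2 : ℝ) = ‖(F a - F b).1‖ := h.symm
        _ ≤ ‖F a - F b‖ := norm_fst_le _
        _ ≤ _ := hL a ha b hb
    have D2 : ∀ a b : X × Y, a ∈ B → b ∈ B → ‖(F a).2 - (F b).2‖ = 2 → 2 ≤ ‖a - b‖ := by
      intro a b ha hb h
      calc (2 : ℝ) = ‖(F a - F b).2‖ := h.symm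
        _ ≤ ‖F a - F b‖ := norm_snd_le _
        _ ≤ _ := hL a ha b hb
    have xp := aux_le_or (D2 x p hx hp (by rw [hpF]; exact n2))
    have xq := aux_le_or (D1 x q hx hq (by rw [hqF]; exact n1))
    have xz := aux_le_or (D1 x z hx hz (by rw [hzF]; exact n1))
    have pq := aux_le_or (D1 p q hp hq (by rw [hqF, hpF]; exact n1))
    have pz := aux_le_or (D1 p z hp hz (by rw [hzF, hpF]; exact n1))
    have qz := aux_le_or (D2 q z hq hz (by rw [hzF, hqF]; exact n2))
    obtain ⟨x1, x2⟩ := (memB x).1 hx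
    obtain ⟨p1, p2⟩ := (memB p).1 hp
    obtain ⟨q1, q2⟩ := (memB q).1 hq
    obtain ⟨z1, z2⟩ := (memB z).1 hz
    refine ⟨le_antisymm x1 ?_, le_antisymm x2 ?_⟩
    · exact aux_four_s19 (x := x.swap) (p := p.swap) (q := q.swap) (z := z.swap)
        x2 p2 q2 z2 x1 p1 q1 z1 xp.symm xq.symm xz.symm pq.symm pz.symm qz.symm
    · exact aux_four_s19 x1 p1 q1 z1 x2 p2 q2 z2 xp xq xz pq pz qz
  -- preimage of the diagonal part
  have hD : ∀ x ∈ B, ‖(F x).1‖ = ‖(F x).2‖ → ‖x.1‖ = ‖x.2‖ := by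
    intro x hx h
    by_cases hz : ‖(F x).1‖ = 0
    · have e1 : (F x).1 = 0 := norm_eq_zero.1 hz
      have e2 : (F x).2 = 0 := norm_eq_zero.1 (h ▸ hz)
      have e : F x = F 0 := by rw [hF0]; exact Prod.ext e1 e2
      rw [hbij.injOn hx h0B e]; simp
    · set r := ‖(F x).1‖ with hr
      have hpos : 0 < r := lt_of_le_of_ne (norm_nonneg _) (Ne.symm hz)
      have hr1 : r ≤ 1 := ((memB _).1 (hbij.mapsTo hx)).1
      have n1 : ‖(r⁻¹ • F x).1‖ = 1 := by
        rw [Prod.smul_fst, norm_smul, ← hr, Real.norm_of_nonneg (by positivity),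
          inv_mul_cancel₀ hz]
      have n2 : ‖(r⁻¹ • F x).2‖ = 1 := by
        rw [Prod.smul_snd, norm_smul, ← h, Real.norm_of_nonneg (by positivity),
          inv_mul_cancel₀ hz]
      obtain ⟨y, hy, hyF⟩ := hbij.surjOn ((memB (r⁻¹ • F x)).2 ⟨n1.le, n2.le⟩)
      obtain ⟨y1, y2⟩ := hext y hy (by rw [hyF]; exact n1) (by rw [hyF]; exact n2)
      have yn : ‖y‖ ≤ 1 := (memB' y).1 hy
      have rn : ‖r • y‖ ≤ r := by
        rw [norm_smul, Real.norm_of_nonneg hpos.le]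
        exact mul_le_of_le_one_right hpos.le yn
      have hry : r • y ∈ B := (memB' _).2 (rn.trans hr1)
      have b1 : ‖F (r • y)‖ ≤ r := (hFle _ hry).trans rn
      have b2 : ‖F (r • y) - F y‖ ≤ 1 - r := by
        refine (hL _ hry _ hy).trans ?_
        have : r • y - y = -((1 - r) • y) := by module
        rw [this, norm_neg, norm_smul, Real.norm_of_nonneg (by linarith)]
        exact mul_le_of_le_one_right (by linarith) yn
      rw [hyF] at b2
      have c1 := aux_scale n1 ((norm_fst_le _).trans b1)
        ((norm_fst_le (F (r • y) - r⁻¹ • F x)).trans b2)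
      have c2 := aux_scale n2 ((norm_snd_le _).trans b1)
        ((norm_snd_le (F (r • y) - r⁻¹ • F x)).trans b2)
      have e : F (r • y) = F x := by
        have : F (r • y) = r • (r⁻¹ • F x) := Prod.ext c1 c2
        rw [this, smul_smul, mul_inv_cancel₀ hz, one_smul]
      rw [← hbij.injOn hry hx e, Prod.smul_fst, Prod.smul_snd, norm_smul, norm_smul, y1, y2]
  have hZX' : ∀ z, z ∈ ZX ↔ z ∈ B ∧ ‖z.2‖ < ‖z.1‖ := by intro z; rw [hZX]; rfl
  have hZY' : ∀ z, z ∈ ZY ↔ z ∈ B ∧ ‖z.1‖ < ‖z.2‖ := by intro z; rw [hZY]; rfl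
  have cX : IsPreconnected ZX := by
    have := aux_conn (G := Y) hdimX
    convert this using 1
    ext z
    rw [hZX', memB]
    exact ⟨fun h => ⟨h.1.1, h.2⟩, fun h => ⟨⟨h.1, h.2.le.trans h.1⟩, h.2⟩⟩
  have cY : IsPreconnected ZY := by
    have := (aux_conn (G := X) hdimY).image Prod.swap continuous_swap.continuousOn
    convert this using 1
    ext z
    rw [hZY', memB, Set.image_swap_eq_preimage_swap]
    exact ⟨fun h => ⟨h.1.2, h.2⟩, fun h => ⟨⟨h.2.le.trans h.1, h.1⟩, h.2⟩⟩
  have hXB : ZX ⊆ B := fun z hz => ((hZX' z).1 hz).1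
  have hYB : ZY ⊆ B := fun z hz => ((hZY' z).1 hz).1
  have hFc : ContinuousOn F B := hne.continuousOn
  let U : Set (X × Y) := {z | ‖z.2‖ < ‖z.1‖}
  let V : Set (X × Y) := {z | ‖z.1‖ < ‖z.2‖}
  have hU : IsOpen U := isOpen_lt (by fun_prop) (by fun_prop)
  have hV : IsOpen V := isOpen_lt (by fun_prop) (by fun_prop)
  have hUV : Disjoint U V := Set.disjoint_left.2 fun z (h1 : ‖z.2‖ < ‖z.1‖) (h2 : ‖z.1‖ < ‖z.2‖) => lt_asymm h1 h2
  have split : ∀ S : Set (X × Y), S ⊆ B → (∀ z ∈ S, ‖z.1‖ ≠ ‖z.2‖) → IsPreconnected S →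
      (∀ z ∈ S, F z ∈ ZX) ∨ (∀ z ∈ S, F z ∈ ZY) := by
    intro S hS hne' hc
    have hc' := hc.image F (hFc.mono hS)
    have hsub : F '' S ⊆ U ∪ V := by
      rintro _ ⟨z, hz, rfl⟩
      rcases lt_trichotomy ‖(F z).1‖ ‖(F z).2‖ with h | h | h
      · exact Or.inr h
      · exact absurd (hD z (hS hz) h) (hne' z hz)
      · exact Or.inl h
    rcases hc'.subset_or_subset hU hV hUV hsub with h | h
    · left; intro z hz
      exact (hZX' _).2 ⟨hbij.mapsTo (hS hz), h ⟨z, hz, rfl⟩⟩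
    · right; intro z hz
      exact (hZY' _).2 ⟨hbij.mapsTo (hS hz), h ⟨z, hz, rfl⟩⟩
  have sX := split ZX hXB (fun z hz => ((hZX' z).1 hz).2.ne') cX
  have sY := split ZY hYB (fun z hz => ((hZY' z).1 hz).2.ne) cY
  -- points of the diagonal part are limits of points of both open parts
  have apx : ∀ d ∈ B, ‖d.1‖ = ‖d.2‖ → d ≠ 0 → ∀ ε > 0,
      (∃ a ∈ ZX, ‖F a - F d‖ ≤ ε) ∧ (∃ a ∈ ZY, ‖F a - F d‖ ≤ ε) := by
    intro d hd h hd0 ε hε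
    have hpos : 0 < ‖d.1‖ := by
      rcases (norm_nonneg d.1).eq_or_lt with h' | h'
      · exact absurd (Prod.ext (norm_eq_zero.1 h'.symm) (norm_eq_zero.1 (h ▸ h'.symm))) hd0
      · exact h'
    obtain ⟨d1, d2⟩ := (memB d).1 hd
    obtain ⟨s, hs0, hs1, hsε⟩ : ∃ s : ℝ, 0 < s ∧ s ≤ 1 ∧ s ≤ ε :=
      ⟨min 1 ε, by positivity, min_le_left _ _, min_le_right _ _⟩
    constructor
    · have ha : (d.1, (1 - s) • d.2) ∈ ZX := by
        have : ‖(1 - s) • d.2‖ < ‖d.1‖ := by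
          rw [norm_smul, Real.norm_of_nonneg (by linarith), ← h]; nlinarith
        exact (hZX' _).2 ⟨(memB _).2 ⟨d1, this.le.trans d1⟩, this⟩
      refine ⟨_, ha, (hL _ (hXB ha) _ hd).trans ?_⟩
      have e : (d.1, (1 - s) • d.2) - d = (0, -(s • d.2)) := by
        apply Prod.ext
        · simp
        · change (1 - s) • d.2 - d.2 = -(s • d.2)
          module
      rw [e, Prod.norm_def]
      simp only [norm_zero, norm_neg, norm_smul, Real.norm_of_nonneg hs0.le]
      exact max_le hε.le (by nlinarith)
    · have ha : ((1 - s) • d.1, d.2) ∈ ZY := by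
        have : ‖(1 - s) • d.1‖ < ‖d.2‖ := by
          rw [norm_smul, Real.norm_of_nonneg (by linarith), ← h]; nlinarith
        exact (hZY' _).2 ⟨(memB _).2 ⟨this.le.trans d2, d2⟩, this⟩
      refine ⟨_, ha, (hL _ (hYB ha) _ hd).trans ?_⟩
      have e : ((1 - s) • d.1, d.2) - d = (-(s • d.1), 0) := by
        apply Prod.ext
        · change (1 - s) • d.1 - d.1 = -(s • d.1)
          module
        · simp
      rw [e, Prod.norm_def]
      simp only [norm_zero, norm_neg, norm_smul, Real.norm_of_nonneg hs0.le]
      exact max_le (by nlinarith) hε.le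
  have cmp : ∀ a b : X × Y, ∀ ε, ‖a - b‖ ≤ ε → 
      |‖a.1‖ - ‖b.1‖| ≤ ε ∧ |‖a.2‖ - ‖b.2‖| ≤ ε := by
    intro a b ε h
    exact ⟨(abs_norm_sub_norm_le _ _).trans ((norm_fst_le (a - b)).trans h),
      (abs_norm_sub_norm_le _ _).trans ((norm_snd_le (a - b)).trans h)⟩
  have limX : ∀ w : X × Y, (∀ ε > 0, ∃ a ∈ ZX, ‖a - w‖ ≤ ε) → ‖w.2‖ ≤ ‖w.1‖ := by
    intro w h
    refine le_of_forall_pos_le_add fun ε hε => ?_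
    obtain ⟨a, ha, h'⟩ := h (ε / 2) (by positivity)
    obtain ⟨h1, h2⟩ := cmp a w _ h'
    have := ((hZX' a).1 ha).2
    rw [abs_le] at h1 h2
    linarith [h1.1, h1.2, h2.1, h2.2]
  have limY : ∀ w : X × Y, (∀ ε > 0, ∃ a ∈ ZY, ‖a - w‖ ≤ ε) → ‖w.1‖ ≤ ‖w.2‖ := by
    intro w h
    refine le_of_forall_pos_le_add fun ε hε => ?_
    obtain ⟨a, ha, h'⟩ := h (ε / 2) (by positivity)
    obtain ⟨h1, h2⟩ := cmp a w _ h'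
    have := ((hZY' a).1 ha).2
    rw [abs_le] at h1 h2
    linarith [h1.1, h1.2, h2.1, h2.2]
  have cases3 : ∀ z ∈ B, z ∈ ZX ∨ z ∈ ZY ∨ ‖z.1‖ = ‖z.2‖ := by
    intro z hz
    rcases lt_trichotomy ‖z.1‖ ‖z.2‖ with h | h | h
    · exact Or.inr (Or.inl ((hZY' z).2 ⟨hz, h⟩))
    · exact Or.inr (Or.inr h)
    · exact Or.inl ((hZX' z).2 ⟨hz, h⟩)
  have dX : ∀ z, z ∈ ZX → z ∈ ZY → False := fun z h1 h2 =>
    lt_asymm ((hZX' z).1 h1).2 ((hZY' z).1 h2).2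
  -- limits of images
  have limD : ∀ (S : Set (X × Y)), (S = ZX ∨ S = ZY) → ∀ d ∈ B, ‖d.1‖ = ‖d.2‖ →
      ((∀ z ∈ S, F z ∈ ZX) → ‖(F d).2‖ ≤ ‖(F d).1‖) ∧
      ((∀ z ∈ S, F z ∈ ZY) → ‖(F d).1‖ ≤ ‖(F d).2‖) := by
    intro S hS d hd h
    by_cases hd0 : d = 0
    · rw [hd0, hF0]; simp
    · have key : ∀ ε > 0, ∃ a ∈ S, ‖F a - F d‖ ≤ ε := by
        intro ε hε
        rcases hS with rfl | rfl
        · exact (apx d hd h hd0 ε hε).1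
        · exact (apx d hd h hd0 ε hε).2
      constructor
      · intro hm
        apply limX
        intro ε hε
        obtain ⟨a, ha, h'⟩ := key ε hε
        exact ⟨F a, hm a ha, h'⟩
      · intro hm
        apply limY
        intro ε hε
        obtain ⟨a, ha, h'⟩ := key ε hε
        exact ⟨F a, hm a ha, h'⟩
  have nX : ∃ z, z ∈ ZX := by
    have : Nontrivial X := by
      by_contra hn
      rw [not_nontrivial_iff_subsingleton] at hn
      rw [rank_subsingleton'] at hdimX
      exact absurd hdimX (by norm_num)
    obtain ⟨e, he⟩ := exists_norm_eq X zero_le_one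
    exact ⟨(e, 0), (hZX' _).2 ⟨(memB _).2 ⟨he.le, by simp⟩, by simp [he]⟩⟩
  have nY : ∃ z, z ∈ ZY := by
    have : Nontrivial Y := by
      by_contra hn
      rw [not_nontrivial_iff_subsingleton] at hn
      rw [rank_subsingleton'] at hdimY
      exact absurd hdimY (by norm_num)
    obtain ⟨e, he⟩ := exists_norm_eq Y zero_le_one
    exact ⟨(0, e), (hZY' _).2 ⟨(memB _).2 ⟨by simp, he.le⟩, by simp [he]⟩⟩
  rcases sX with sX | sX <;> rcases sY with sY | sY
  · exfalso
    obtain ⟨w, hw⟩ := nY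
    obtain ⟨z, hz, rfl⟩ := hbij.surjOn (hYB hw)
    rcases cases3 z hz with h | h | h
    · exact dX _ (sX z h) hw
    · exact dX _ (sY z h) hw
    · exact absurd ((limD ZX (Or.inl rfl) z hz h).1 sX) (not_le.2 ((hZY' _).1 hw).2)
  · left
    have hdd : ∀ d ∈ B, ‖d.1‖ = ‖d.2‖ → ‖(F d).1‖ = ‖(F d).2‖ := fun d hd h =>
      le_antisymm ((limD ZY (Or.inr rfl) d hd h).2 sY) ((limD ZX (Or.inl rfl) d hd h).1 sX)
    constructor
    · apply Set.Subset.antisymm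
      · rintro _ ⟨z, hz, rfl⟩; exact sX z hz
      · intro w hw
        obtain ⟨z, hz, rfl⟩ := hbij.surjOn (hXB hw)
        rcases cases3 z hz with h | h | h
        · exact ⟨z, h, rfl⟩
        · exact (dX _ hw (sY z h)).elim
        · exact absurd (hdd z hz h) ((hZX' _).1 hw).2.ne'
    · apply Set.Subset.antisymm
      · rintro _ ⟨z, hz, rfl⟩; exact sY z hz
      · intro w hw
        obtain ⟨z, hz, rfl⟩ := hbij.surjOn (hYB hw)
        rcases cases3 z hz with h | h | h
        · exact (dX _ (sX z h) hw).elim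
        · exact ⟨z, h, rfl⟩
        · exact absurd (hdd z hz h) ((hZY' _).1 hw).2.ne
  · right
    have hdd : ∀ d ∈ B, ‖d.1‖ = ‖d.2‖ → ‖(F d).1‖ = ‖(F d).2‖ := fun d hd h =>
      le_antisymm ((limD ZX (Or.inl rfl) d hd h).2 sX) ((limD ZY (Or.inr rfl) d hd h).1 sY)
    constructor
    · apply Set.Subset.antisymm
      · rintro _ ⟨z, hz, rfl⟩; exact sX z hz
      · intro w hw
        obtain ⟨z, hz, rfl⟩ := hbij.surjOn (hYB hw)
        rcases cases3 z hz with h | h | h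
        · exact ⟨z, h, rfl⟩
        · exact (dX _ (sY z h) hw).elim
        · exact absurd (hdd z hz h) ((hZY' _).1 hw).2.ne
    · apply Set.Subset.antisymm
      · rintro _ ⟨z, hz, rfl⟩; exact sY z hz
      · intro w hw
        obtain ⟨z, hz, rfl⟩ := hbij.surjOn (hXB hw)
        rcases cases3 z hz with h | h | h
        · exact (dX _ hw (sX z h)).elim
        · exact ⟨z, h, rfl⟩
        · exact absurd (hdd z hz h) ((hZX' _).1 hw).2.ne'
  · exfalso
    obtain ⟨w, hw⟩ := nX
    obtain ⟨z, hz, rfl⟩ := hbij.surjOn (hXB hw)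
    rcases cases3 z hz with h | h | h
    · exact dX _ hw (sX z h)
    · exact dX _ hw (sY z h)
    · exact absurd ((limD ZX (Or.inl rfl) z hz h).2 sX) (not_le.2 ((hZX' _).1 hw).2)
end
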